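/- arXiv:0904.1227 — 2 statements merged into one kernel-verified Lean document; each statement's English description precedes it below -/
import Mathlib

section
/- Let n ≥ 2 and k ≥ 1. For i = 1, …, k let w^{(i)}, v^{(i)} ∈ {0,1}^{{-1,1}^n} each have Hamming weight 2^{n-1}, and suppose that for each i either w^{(i)} = v^{(i)} or dist(w^{(i)}, v^{(i)}) ≥ 2^n/4, and that w^{(i)} ≠ v^{(i)} for at least k/2 indices i. Let A = B_{w^{(1)}} × ⋯ × B_{w^{(k)}} ⊆ ℝ^{kn} and B = B_{v^{(1)}} × ⋯ × B_{v^{(k)}} ⊆ ℝ^{kn}. Then vol(A) = vol(B) and vol(A ∩ B)/vol(A) ≤ (1 - 1/(8n))^{k/2} < e^{-k/(16n)}; in particular dist(A, B) = 1 - vol(A ∩ B)/vol(A) > 1 - e^{-k/(16n)}. -/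
open MeasureTheory Set ENNReal Finset

/-- The cross polytope `O_n`: the convex hull of `{±e_i : i ∈ [n]}`. -/
noncomputable def crossPolytope (n : ℕ) : Set (Fin n → ℝ) :=
  convexHull ℝ ((Set.range fun i : Fin n => Pi.single i (1 : ℝ)) ∪
    (Set.range fun i : Fin n => Pi.single i (-1 : ℝ)))

/-- The sign vector in `{-1,1}^n` associated to `b : Fin n → Bool`. -/
def signVec (n : ℕ) (b : Fin n → Bool) : Fin n → ℝ := fun i => if b i then 1 else -1

/-- The peak attached to the facet `F_s = conv{s_i e_i}`, namely
`conv(F_s ∪ {s/(n-1)})`. -/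
noncomputable def peak (n : ℕ) (s : Fin n → ℝ) : Set (Fin n → ℝ) :=
  convexHull ℝ ((Set.range fun i : Fin n => Pi.single i (s i)) ∪ {((n : ℝ) - 1)⁻¹ • s})

/-- The cross polytope with the peaks indexed by the 0–1 vector `w` attached. -/
noncomputable def body (n : ℕ) (w : (Fin n → Bool) → Bool) : Set (Fin n → ℝ) :=
  crossPolytope n ∪ ⋃ (b : Fin n → Bool) (_ : w b = true), peak n (signVec n b)

/-- The Hamming weight of a binary word: the number of coordinates equal to `true`. -/
def wt {ι : Type*} [Fintype ι] (c : ι → Bool) : ℕ :=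
  (Finset.univ.filter fun i => c i = true).card

/-- The corner simplex `conv{0, e_1, …, e_n}`. -/
noncomputable def cornerSimplex (n : ℕ) : Set (Fin n → ℝ) :=
  convexHull ℝ (insert 0 (Set.range fun i : Fin n => Pi.single i (1 : ℝ)))

theorem mem_cornerSimplex {n : ℕ} {y : Fin n → ℝ} (hy : ∀ i, 0 ≤ y i) (hsum : ∑ i, y i ≤ 1) :
    y ∈ cornerSimplex n := by
  have key := (convex_convexHull ℝ
    (insert (0 : Fin n → ℝ) (Set.range fun i : Fin n => Pi.single i (1 : ℝ)))).sum_mem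
    (t := (Finset.univ : Finset (Option (Fin n))))
    (w := fun o => o.elim (1 - ∑ i, y i) y)
    (z := fun o => o.elim 0 fun i => Pi.single i 1)
    (by rintro (_ | i) - <;> simp [hy, hsum]) (by simp [Fintype.sum_option])
    (by
      rintro (_ | i) -
      · exact subset_convexHull ℝ _ (by simp)
      · exact subset_convexHull ℝ _ (by simp))
  convert! key using 1
  ext j
  simp [Fintype.sum_option, Finset.sum_apply, Pi.single_apply]

theorem volume_cornerSimplex_ne_top (n : ℕ) : volume (cornerSimplex n) ≠ ⊤ :=
  (((Set.finite_range _).insert 0).isCompact_convexHull ℝ).measure_lt_top.ne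

theorem volume_real_cornerSimplex_pos {n : ℕ} (hn : 0 < n) :
    0 < volume.real (cornerSimplex n) := by
  have hn' : (0 : ℝ) < n := by exact_mod_cast hn
  have hsub : (Set.univ.pi fun _ : Fin n => Set.Icc (0 : ℝ) (1 / n)) ⊆ cornerSimplex n := by
    intro y hy
    simp only [Set.mem_pi, Set.mem_univ, true_implies, Set.mem_Icc] at hy
    refine mem_cornerSimplex (fun i => (hy i).1) ?_
    calc ∑ i, y i ≤ ∑ _i : Fin n, 1 / (n : ℝ) := Finset.sum_le_sum fun i _ => (hy i).2
      _ = 1 := by simp [hn'.ne']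
  refine ENNReal.toReal_pos ?_ (volume_cornerSimplex_ne_top n)
  refine (lt_of_lt_of_le ?_ (measure_mono hsub)).ne'
  rw [volume_pi_pi, pos_iff_ne_zero, Finset.prod_ne_zero_iff]
  intro i _
  simp [Real.volume_Icc, hn]

theorem signVec_mul_self (n : ℕ) (b : Fin n → Bool) (i : Fin n) :
    signVec n b i * signVec n b i = 1 := by
  unfold signVec; split_ifs <;> norm_num

theorem abs_signVec (n : ℕ) (b : Fin n → Bool) (i : Fin n) : |signVec n b i| = 1 := by
  unfold signVec; split_ifs <;> norm_num

theorem volume_real_image_linear_add {n : ℕ} (f : (Fin n → ℝ) →ₗ[ℝ] (Fin n → ℝ))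
    (p : Fin n → ℝ) (s : Set (Fin n → ℝ)) :
    volume.real ((fun x => p + f x) '' s) = |LinearMap.det f| * volume.real s := by
  rw [← Set.image_image (fun x => p + x) f s, Measure.real, Set.image_add_left,
    measure_preimage_add, Measure.addHaar_image_linearMap, ENNReal.toReal_mul,
    ENNReal.toReal_ofReal (abs_nonneg _), Measure.real]

theorem abs_det_diagonal_signVec (n : ℕ) (b : Fin n → Bool) :
    |(Matrix.diagonal (signVec n b)).det| = 1 := by
  simp [Matrix.det_diagonal, Finset.abs_prod, abs_signVec]

theorem det_one_sub_const (n : ℕ) (r : ℝ) :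
    (1 - Matrix.of fun _ _ : Fin n => r).det = 1 - n * r := by
  have h : (Matrix.of fun _ _ : Fin n => r) =
      (Matrix.of fun (_ : Fin n) (_ : Unit) => r) * Matrix.of fun (_ : Unit) (_ : Fin n) => (1 : ℝ) := by
    ext i j; simp [Matrix.mul_apply]
  rw [h, Matrix.det_one_sub_mul_comm, Matrix.det_unique]
  simp [Matrix.mul_apply]

theorem peak_eq_image (n : ℕ) (s : Fin n → ℝ) :
    peak n s = (fun x => ((n : ℝ) - 1)⁻¹ • s +
      Matrix.toLin' (Matrix.diagonal s * (1 - Matrix.of fun _ _ => ((n : ℝ) - 1)⁻¹)) x) ''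
        cornerSimplex n := by
  set L := Matrix.toLin' (Matrix.diagonal s * (1 - Matrix.of fun _ _ : Fin n => ((n : ℝ) - 1)⁻¹))
    with hL
  have h := (AffineMap.const ℝ (Fin n → ℝ) (((n : ℝ) - 1)⁻¹ • s) + L.toAffineMap).image_convexHull
    (insert 0 (Set.range fun i : Fin n => Pi.single i (1 : ℝ)))
  have hfun : ⇑(AffineMap.const ℝ (Fin n → ℝ) (((n : ℝ) - 1)⁻¹ • s) + L.toAffineMap) =
      fun x => ((n : ℝ) - 1)⁻¹ • s + L x := by
    ext x; simp
  rw [hfun] at h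
  rw [cornerSimplex, h, peak, Set.image_insert_eq, ← Set.range_comp, Set.union_singleton]
  congr 2
  · simp
  · congr 1
    ext i j
    simp [hL, Matrix.diagonal_mul, Pi.single_apply, mul_sub]
    ring

theorem volume_real_peak {n : ℕ} (hn : 2 ≤ n) (b : Fin n → Bool) :
    volume.real (peak n (signVec n b)) = volume.real (cornerSimplex n) / ((n : ℝ) - 1) := by
  have hn' : (0 : ℝ) < (n : ℝ) - 1 := by
    have : (2 : ℝ) ≤ n := by exact_mod_cast hn
    linarith
  rw [peak_eq_image, volume_real_image_linear_add, LinearMap.det_toLin', Matrix.det_mul, abs_mul,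
    abs_det_diagonal_signVec, det_one_sub_const, one_mul, div_eq_inv_mul]
  congr 1
  rw [show 1 - (n : ℝ) * ((n : ℝ) - 1)⁻¹ = -((n : ℝ) - 1)⁻¹ by field_simp; ring, abs_neg,
    abs_of_pos (inv_pos.2 hn')]

theorem isCompact_peak (n : ℕ) (s : Fin n → ℝ) : IsCompact (peak n s) :=
  ((Set.finite_range _).union (Set.finite_singleton _)).isCompact_convexHull ℝ

theorem isCompact_crossPolytope (n : ℕ) : IsCompact (crossPolytope n) :=
  ((Set.finite_range _).union (Set.finite_range _)).isCompact_convexHull ℝ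

theorem isCompact_body (n : ℕ) (w : (Fin n → Bool) → Bool) : IsCompact (body n w) :=
  (isCompact_crossPolytope n).union <| isCompact_iUnion fun _ => isCompact_iUnion fun _ =>
    isCompact_peak n _

theorem sum_signVec_mul_le_one {n : ℕ} (b : Fin n → Bool) {x : Fin n → ℝ}
    (hx : x ∈ crossPolytope n) : ∑ i, signVec n b i * x i ≤ 1 := by
  have hconv : Convex ℝ {x : Fin n → ℝ | ∑ i, signVec n b i * x i ≤ 1} :=
    convex_halfSpace_le (f := fun x : Fin n → ℝ => ∑ i, signVec n b i * x i)
      ⟨fun x y => by simp [mul_add, Finset.sum_add_distrib],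
        fun c x => by simp [Finset.mul_sum, mul_left_comm]⟩ 1
  refine convexHull_min ?_ hconv hx
  rintro _ (⟨i, rfl⟩ | ⟨i, rfl⟩)
  · simpa [Pi.single_apply] using (le_abs_self _).trans (abs_signVec n b i).le
  · simpa [Pi.single_apply] using (neg_le_abs _).trans (abs_signVec n b i).le

theorem one_le_sum_signVec_mul {n : ℕ} (hn : 2 ≤ n) (b : Fin n → Bool) {x : Fin n → ℝ}
    (hx : x ∈ peak n (signVec n b)) : 1 ≤ ∑ i, signVec n b i * x i := by
  have hn' : (0 : ℝ) < (n : ℝ) - 1 := by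
    have : (2 : ℝ) ≤ n := by exact_mod_cast hn
    linarith
  have hconv : Convex ℝ {x : Fin n → ℝ | 1 ≤ ∑ i, signVec n b i * x i} :=
    convex_halfSpace_ge (f := fun x : Fin n → ℝ => ∑ i, signVec n b i * x i)
      ⟨fun x y => by simp [mul_add, Finset.sum_add_distrib],
        fun c x => by simp [Finset.mul_sum, mul_left_comm]⟩ 1
  refine convexHull_min ?_ hconv hx
  rintro _ (⟨i, rfl⟩ | rfl)
  · simp [Pi.single_apply, signVec_mul_self]
  · simp only [Set.mem_ofPred_eq, Pi.smul_apply, smul_eq_mul, mul_left_comm _ ((n : ℝ) - 1)⁻¹,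
      signVec_mul_self, mul_one, Finset.sum_const, Finset.card_univ, Fintype.card_fin, nsmul_eq_mul]
    rw [← div_eq_mul_inv, le_div_iff₀ hn']
    linarith

theorem signVec_mul_nonneg {n : ℕ} (hn : 2 ≤ n) (b : Fin n → Bool) {x : Fin n → ℝ}
    (hx : x ∈ peak n (signVec n b)) (i : Fin n) : 0 ≤ signVec n b i * x i := by
  have hn' : (0 : ℝ) < (n : ℝ) - 1 := by
    have : (2 : ℝ) ≤ n := by exact_mod_cast hn
    linarith
  have hconv : Convex ℝ {x : Fin n → ℝ | 0 ≤ signVec n b i * x i} :=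
    convex_halfSpace_ge (f := fun x : Fin n → ℝ => signVec n b i * x i)
      ⟨fun x y => by simp [mul_add], fun c x => by simp [mul_left_comm]⟩ 0
  refine convexHull_min ?_ hconv hx
  rintro _ (⟨j, rfl⟩ | rfl)
  · by_cases h : i = j
    · subst h; simp [signVec_mul_self]
    · simp [h]
  · simp only [Set.mem_ofPred_eq, Pi.smul_apply, smul_eq_mul, mul_left_comm _ ((n : ℝ) - 1)⁻¹,
      signVec_mul_self, mul_one]
    positivity

theorem volume_setOf_linear_eq {n : ℕ} (f : (Fin n → ℝ) →ₗ[ℝ] ℝ) (hf : f ≠ 0) (c : ℝ) :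
    volume {x | f x = c} = 0 := by
  let s : AffineSubspace ℝ (Fin n → ℝ) :=
    { carrier := {x | f x = c}
      smul_vsub_vadd_mem' := by
        intro r p q t hp hq ht
        simp only [Set.mem_ofPred_eq] at hp hq ht
        simp [hp, hq, ht] }
  refine Measure.addHaar_affineSubspace volume s fun h => hf ?_
  have hall (x) : f x = c := by
    have : x ∈ s := h ▸ AffineSubspace.mem_top ℝ _ x
    exact this
  ext x
  have h0 := hall 0
  simp only [map_zero] at h0
  simp [hall, ← h0]

theorem aedisjoint_crossPolytope_peak {n : ℕ} (hn : 2 ≤ n) (b : Fin n → Bool) :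
    AEDisjoint volume (crossPolytope n) (peak n (signVec n b)) := by
  have hne : (Fintype.linearCombination ℝ (signVec n b)) ≠ 0 := by
    intro h
    have := LinearMap.congr_fun h (Pi.single ⟨0, by omega⟩ 1)
    rw [Fintype.linearCombination_apply_single] at this
    have h1 := abs_signVec n b ⟨0, by omega⟩
    simp_all
  refine measure_mono_null ?_ (volume_setOf_linear_eq _ hne 1)
  rintro x ⟨h1, h2⟩
  have := le_antisymm (sum_signVec_mul_le_one b h1) (one_le_sum_signVec_mul hn b h2)
  simpa [Fintype.linearCombination_apply, mul_comm] using this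

theorem aedisjoint_peak_peak {n : ℕ} (hn : 2 ≤ n) {b c : Fin n → Bool} (hbc : b ≠ c) :
    AEDisjoint volume (peak n (signVec n b)) (peak n (signVec n c)) := by
  obtain ⟨i, hi⟩ := Function.ne_iff.1 hbc
  have hne : (LinearMap.proj i : (Fin n → ℝ) →ₗ[ℝ] ℝ) ≠ 0 := by
    intro h
    have := LinearMap.congr_fun h (Pi.single i 1)
    simp at this
  refine measure_mono_null ?_ (volume_setOf_linear_eq _ hne 0)
  rintro x ⟨h1, h2⟩
  have h1 := signVec_mul_nonneg hn b h1 i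
  have h2 := signVec_mul_nonneg hn c h2 i
  simp only [Set.mem_ofPred_eq, LinearMap.proj_apply]
  unfold signVec at h1 h2
  cases hb : b i <;> cases hc : c i <;> simp_all <;> linarith

theorem volume_real_crossPolytope_le (n : ℕ) :
    volume.real (crossPolytope n) ≤ 2 ^ n * volume.real (cornerSimplex n) := by
  have himg (b : Fin n → Bool) :
      volume.real ((fun x => 0 + Matrix.toLin' (Matrix.diagonal (signVec n b)) x) ''
        cornerSimplex n) = volume.real (cornerSimplex n) := by
    rw [volume_real_image_linear_add, LinearMap.det_toLin', abs_det_diagonal_signVec, one_mul]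
  have hcomp : IsCompact (cornerSimplex n) :=
    ((Set.finite_range _).insert 0).isCompact_convexHull ℝ
  have hsub : crossPolytope n ⊆ ⋃ b : Fin n → Bool,
      (fun x => 0 + Matrix.toLin' (Matrix.diagonal (signVec n b)) x) '' cornerSimplex n := by
    intro x hx
    let b : Fin n → Bool := fun i => decide (0 ≤ x i)
    have hb (i) : signVec n b i * x i = |x i| := by
      by_cases h : 0 ≤ x i
      · simp [signVec, b, h, abs_of_nonneg h]
      · simp [signVec, b, h, abs_of_neg (not_le.1 h)]
    refine Set.mem_iUnion.2 ⟨b, fun i => signVec n b i * x i, mem_cornerSimplex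
      (fun i => by rw [hb]; positivity) (sum_signVec_mul_le_one b hx), ?_⟩
    ext i
    simp [Matrix.mulVec_diagonal, ← mul_assoc, signVec_mul_self]
  refine (measureReal_mono hsub ?_).trans ((measureReal_iUnion_fintype_le _).trans ?_)
  · refine (isCompact_iUnion fun b => hcomp.image ?_).measure_lt_top.ne
    exact continuous_const.add (LinearMap.continuous_of_finiteDimensional _)
  · simp only [himg, Finset.sum_const, Finset.card_univ]
    simp

theorem volume_real_body {n : ℕ} (hn : 2 ≤ n) (w : (Fin n → Bool) → Bool) :
    volume.real (body n w) = volume.real (crossPolytope n) +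
      wt w * (volume.real (cornerSimplex n) / ((n : ℝ) - 1)) := by
  have hbody : body n w = crossPolytope n ∪
      ⋃ b ∈ Finset.univ.filter fun b => w b = true, peak n (signVec n b) := by
    simp [body]
  have hfin (b) : volume (peak n (signVec n b)) ≠ ⊤ := (isCompact_peak n _).measure_lt_top.ne
  have hm (b) : MeasurableSet (peak n (signVec n b)) := (isCompact_peak n _).measurableSet
  have hdisj : AEDisjoint volume (crossPolytope n)
      (⋃ b ∈ Finset.univ.filter fun b => w b = true, peak n (signVec n b)) := by
    rw [AEDisjoint, Set.inter_iUnion₂]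
    exact (measure_biUnion_null_iff (Finset.countable_toSet _)).2 fun b _ =>
      aedisjoint_crossPolytope_peak hn b
  rw [hbody, measureReal_union₀
      (Finset.measurableSet_biUnion _ fun b _ => hm b).nullMeasurableSet hdisj
      (isCompact_crossPolytope n).measure_lt_top.ne
      (Finset.isCompact_biUnion _ fun b _ => isCompact_peak n _).measure_lt_top.ne,
    measureReal_biUnion_finset₀ (fun b _ c _ hbc => aedisjoint_peak_peak hn hbc)
      (fun b _ => (hm b).nullMeasurableSet) fun b _ => hfin b]
  simp [volume_real_peak hn, wt]

theorem body_union_body (n : ℕ) (w v : (Fin n → Bool) → Bool) :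
    body n w ∪ body n v = body n fun b => w b || v b := by
  ext x
  simp only [body, Set.mem_union, Set.mem_iUnion, Bool.or_eq_true, exists_prop]
  constructor
  · rintro ((h | ⟨b, hb, h⟩) | (h | ⟨b, hb, h⟩))
    exacts [.inl h, .inr ⟨b, .inl hb, h⟩, .inl h, .inr ⟨b, .inr hb, h⟩]
  · rintro (h | ⟨b, hb | hb, h⟩)
    exacts [.inl (.inl h), .inl (.inr ⟨b, hb, h⟩), .inr (.inr ⟨b, hb, h⟩)]

theorem two_mul_wt_or {ι : Type*} [Fintype ι] (w v : ι → Bool) :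
    2 * wt (fun b => w b || v b) = wt w + wt v + hammingDist w v := by
  simp only [wt, hammingDist, Finset.card_filter, Finset.mul_sum, ← Finset.sum_add_distrib]
  refine Finset.sum_congr rfl fun i _ => ?_
  cases w i <;> cases v i <;> simp

theorem volume_real_body_pos {n : ℕ} (hn : 2 ≤ n) {w : (Fin n → Bool) → Bool} (hw : 0 < wt w) :
    0 < volume.real (body n w) := by
  have hn' : (2 : ℝ) ≤ n := by exact_mod_cast hn
  have hw' : (0 : ℝ) < wt w := by exact_mod_cast hw
  rw [volume_real_body hn]
  have h := volume_real_cornerSimplex_pos (n := n) (by omega)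
  have := mul_pos hw' (div_pos h (show (0 : ℝ) < n - 1 by linarith))
  linarith [measureReal_nonneg (μ := volume) (s := crossPolytope n)]

/-- Two half-weight bodies at Hamming distance at least `2 ^ n / 4` overlap in at most a
`1 - 1 / (8 n)` fraction of their volume. -/
theorem volume_real_body_inter_le {n : ℕ} (hn : 2 ≤ n) {w v : (Fin n → Bool) → Bool}
    (hw : wt w = 2 ^ (n - 1)) (hv : wt v = 2 ^ (n - 1)) (hd : 2 ^ n / 4 ≤ hammingDist w v) :
    volume.real (body n w ∩ body n v) ≤ (1 - 1 / (8 * (n : ℝ))) * volume.real (body n w) := by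
  have hn' : (2 : ℝ) ≤ n := by exact_mod_cast hn
  have hor := two_mul_wt_or w v
  obtain ⟨m, hm⟩ : ∃ m, n = m + 2 := ⟨n - 2, by omega⟩
  have hpow : 2 ^ n = 4 * 2 ^ m := by rw [hm, pow_add]; ring
  have hpow1 : 2 ^ (n - 1) = 2 * 2 ^ m := by
    rw [hm, show m + 2 - 1 = m + 1 by omega, pow_succ]; ring
  have hor' : 5 * 2 ^ m ≤ 2 * wt (fun b => w b || v b) := by
    rw [hw, hv] at hor; omega
  have horR : (5 : ℝ) * 2 ^ m ≤ 2 * wt (fun b => w b || v b) := by exact_mod_cast hor'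
  have hwR : (wt w : ℝ) = 2 * 2 ^ m := by rw [hw, hpow1]; push_cast; ring
  have hvR : (wt v : ℝ) = 2 * 2 ^ m := by rw [hv, hpow1]; push_cast; ring
  have hui := measureReal_union_add_inter (μ := volume) (s := body n w)
    (isCompact_body n v).measurableSet (isCompact_body n w).measure_lt_top.ne
    (isCompact_body n v).measure_lt_top.ne
  rw [body_union_body, volume_real_body hn, volume_real_body hn, volume_real_body hn, hwR, hvR]
    at hui
  rw [volume_real_body hn, hwR]
  have hc := volume_real_cornerSimplex_pos (n := n) (by omega)
  have hV := volume_real_crossPolytope_le n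
  set V := volume.real (crossPolytope n)
  set p := volume.real (cornerSimplex n) / ((n : ℝ) - 1) with hp
  have hcp : volume.real (cornerSimplex n) = ((n : ℝ) - 1) * p := by
    rw [hp]; field_simp [show (n : ℝ) - 1 ≠ 0 by linarith]
  have hp0 : 0 < p := div_pos hc (by linarith)
  rw [hcp, show (2 : ℝ) ^ n = 4 * 2 ^ m by exact_mod_cast hpow] at hV
  have hq : (0 : ℝ) < 2 ^ m := by positivity
  have hmul := mul_le_mul_of_nonneg_right horR hp0.le
  have hkey : 1 / (8 * (n : ℝ)) * (V + 2 * 2 ^ m * p) ≤ 2 ^ m * p / 2 := by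
    rw [one_div, inv_mul_le_iff₀ (by positivity)]
    nlinarith [mul_pos hq hp0]
  linarith

theorem product_bodies_far (n k : ℕ) (hn : 2 ≤ n) (hk : 1 ≤ k)
    (w v : Fin k → ((Fin n → Bool) → Bool))
    (hw : ∀ i, wt (w i) = 2 ^ (n - 1)) (hv : ∀ i, wt (v i) = 2 ^ (n - 1))
    (hfar : ∀ i, w i = v i ∨ 2 ^ n / 4 ≤ hammingDist (w i) (v i))
    (hhalf : (k : ℝ) / 2 ≤ (Finset.univ.filter fun i => w i ≠ v i).card) :
    volume (Set.univ.pi fun i => body n (w i)) =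
      volume (Set.univ.pi fun i => body n (v i)) ∧
    (volume ((Set.univ.pi fun i => body n (w i)) ∩
        (Set.univ.pi fun i => body n (v i)))).toReal /
        (volume (Set.univ.pi fun i => body n (w i))).toReal ≤
      (1 - 1 / (8 * (n : ℝ))) ^ ((k : ℝ) / 2) ∧
    ((1 - 1 / (8 * (n : ℝ))) ^ ((k : ℝ) / 2) < Real.exp (-(k : ℝ) / (16 * n))) ∧
    (volume ((Set.univ.pi fun i => body n (w i)) \
        (Set.univ.pi fun i => body n (v i)))).toReal /
        (volume (Set.univ.pi fun i => body n (w i))).toReal =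
      1 - (volume ((Set.univ.pi fun i => body n (w i)) ∩
        (Set.univ.pi fun i => body n (v i)))).toReal /
        (volume (Set.univ.pi fun i => body n (w i))).toReal ∧
    1 - Real.exp (-(k : ℝ) / (16 * n)) <
      (volume ((Set.univ.pi fun i => body n (w i)) \
        (Set.univ.pi fun i => body n (v i)))).toReal /
        (volume (Set.univ.pi fun i => body n (w i))).toReal := by
  have hn' : (2 : ℝ) ≤ n := by exact_mod_cast hn
  have hk' : (0 : ℝ) < k := by exact_mod_cast hk
  have hpos (i) : 0 < volume.real (body n (w i)) :=
    volume_real_body_pos hn (by rw [hw]; positivity)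
  have hx0 : 0 < 1 / (8 * (n : ℝ)) := by positivity
  have hx1 : 1 / (8 * (n : ℝ)) < 1 := by
    rw [div_lt_one (by positivity)]; linarith
  have hr0 : 0 < 1 - 1 / (8 * (n : ℝ)) := by linarith
  have hcompact (u : Fin k → ((Fin n → Bool) → Bool)) :
      IsCompact (Set.univ.pi fun i => body n (u i)) :=
    isCompact_univ_pi fun i => isCompact_body n (u i)
  have hpi (s : Fin k → Set (Fin n → ℝ)) :
      volume.real (Set.univ.pi s) = ∏ i, volume.real (s i) := by
    simp [Measure.real, volume_pi_pi, ENNReal.toReal_prod]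
  have hA : 0 < volume.real (Set.univ.pi fun i => body n (w i)) := by
    rw [hpi]; exact Finset.prod_pos fun i _ => hpos i
  have hvol : volume (Set.univ.pi fun i => body n (w i)) =
      volume (Set.univ.pi fun i => body n (v i)) := by
    rw [← ENNReal.toReal_eq_toReal_iff' (hcompact w).measure_lt_top.ne
      (hcompact v).measure_lt_top.ne]
    change volume.real _ = volume.real _
    simp only [hpi, volume_real_body hn, hw, hv]
  have hratio : volume.real ((Set.univ.pi fun i => body n (w i)) ∩
        (Set.univ.pi fun i => body n (v i))) /
        volume.real (Set.univ.pi fun i => body n (w i)) ≤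
      (1 - 1 / (8 * (n : ℝ))) ^ ((k : ℝ) / 2) := by
    rw [div_le_iff₀ hA, ← Set.pi_inter_distrib, hpi, hpi]
    calc ∏ i, volume.real (body n (w i) ∩ body n (v i))
        ≤ ∏ i, (if w i ≠ v i then 1 - 1 / (8 * (n : ℝ)) else 1) * volume.real (body n (w i)) := by
          refine Finset.prod_le_prod (fun i _ => measureReal_nonneg) fun i _ => ?_
          split_ifs with h
          · exact volume_real_body_inter_le hn (hw i) (hv i) ((hfar i).resolve_left h)
          · rw [not_not.1 h, Set.inter_self, one_mul]
      _ = (1 - 1 / (8 * (n : ℝ))) ^ (Finset.univ.filter fun i => w i ≠ v i).card *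
            ∏ i, volume.real (body n (w i)) := by
          rw [Finset.prod_mul_distrib, Finset.prod_ite]
          simp
      _ ≤ _ := by
          rw [← Real.rpow_natCast]
          gcongr ?_ * _
          exact Real.rpow_le_rpow_of_exponent_ge hr0 (by linarith) hhalf
  have hexp : (1 - 1 / (8 * (n : ℝ))) ^ ((k : ℝ) / 2) < Real.exp (-(k : ℝ) / (16 * n)) := by
    have h : 1 - 1 / (8 * (n : ℝ)) < Real.exp (-(1 / (8 * (n : ℝ)))) := by
      have := Real.add_one_lt_exp (neg_ne_zero.2 hx0.ne')
      linarith
    refine (Real.rpow_lt_rpow hr0.le h (by positivity)).trans_eq ?_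
    rw [← Real.exp_mul]
    congr 1
    field_simp
    norm_num
  have hdiff : volume.real ((Set.univ.pi fun i => body n (w i)) \
        (Set.univ.pi fun i => body n (v i))) /
        volume.real (Set.univ.pi fun i => body n (w i)) =
      1 - volume.real ((Set.univ.pi fun i => body n (w i)) ∩
        (Set.univ.pi fun i => body n (v i))) /
        volume.real (Set.univ.pi fun i => body n (w i)) := by
    have := measureReal_inter_add_sdiff (μ := volume) (s := Set.univ.pi fun i => body n (w i))
      (hcompact v).measurableSet (hcompact w).measure_lt_top.ne
    rw [eq_sub_iff_add_eq, ← add_div, add_comm, this, div_self hA.ne']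
  refine ⟨hvol, hratio, hexp, hdiff, ?_⟩
  change _ < volume.real _ / volume.real _
  rw [hdiff]
  linarith
end

section
/- For every constant t > 0 there exists d₀ such that for all d ≥ d₀ there exist convex bodies K, L ⊆ ℝ^d of equal positive Lebesgue volume that are 1/d^t-halfspace-close, i.e., for every halfspace H = { x ∈ ℝ^d : a·x ≤ b } (a ∈ ℝ^d, b ∈ ℝ) one has |vol(K ∩ H)/vol(K) − vol(L ∩ H)/vol(L)| ≤ 1/d^t, and yet dist(K, L) > 1/8. -/
open MeasureTheory Set ENNReal Finset

/-- Exponential moment bound for a function of uniform random signs with bounded differences. -/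
theorem sum_exp_le_of_bounded_differences (c : ℝ) (N : ℕ) (f : (Fin N → Bool) → ℝ)
    (hf : ∀ ε i, |f ε - f (Function.update ε i (!ε i))| ≤ c) (l : ℝ) :
    ∑ ε, Real.exp (l * f ε) ≤
      2 ^ N * Real.exp (l * ((∑ ε, f ε) / 2 ^ N) + N * (l ^ 2 * c ^ 2 / 8)) := by
  induction N with
  | zero => simp
  | succ N ih =>
    have split : ∀ g : (Fin (N + 1) → Bool) → ℝ, ∑ ε, g ε =
        ∑ ε : Fin N → Bool, (g (Fin.cons true ε) + g (Fin.cons false ε)) := by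
      intro g
      rw [← (Fin.consEquiv (fun _ => Bool)).sum_comp g, Fintype.sum_prod_type, Fintype.sum_bool,
        ← Finset.sum_add_distrib]
      rfl
    set g : (Fin N → Bool) → ℝ := fun ε => (f (Fin.cons true ε) + f (Fin.cons false ε)) / 2 with hg
    have hgd : ∀ ε i, |g ε - g (Function.update ε i (!ε i))| ≤ c := by
      intro ε i
      have h1 := hf (Fin.cons true ε) i.succ
      have h2 := hf (Fin.cons false ε) i.succ
      rw [Fin.cons_succ, ← Fin.cons_update] at h1 h2
      rw [abs_le] at h1 h2 ⊢
      simp only [hg]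
      constructor <;> linarith [h1.1, h1.2, h2.1, h2.2]
    have hmean : (∑ ε, g ε) / 2 ^ N = (∑ ε, f ε) / 2 ^ (N + 1) := by
      rw [split f, hg, ← Finset.sum_div, pow_succ, div_div, mul_comm (2 : ℝ)]
    have hstep : ∀ ε, Real.exp (l * f (Fin.cons true ε)) + Real.exp (l * f (Fin.cons false ε)) ≤
        2 * Real.exp (l ^ 2 * c ^ 2 / 8) * Real.exp (l * g ε) := by
      intro ε
      have hd := hf (Fin.cons true ε) 0
      rw [Fin.update_cons_zero, Fin.cons_zero, Bool.not_true] at hd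
      set a := f (Fin.cons true ε)
      set b := f (Fin.cons false ε)
      have h1 : Real.exp (l * a) + Real.exp (l * b) =
          2 * Real.cosh (l * (a - b) / 2) * Real.exp (l * g ε) := by
        rw [Real.cosh_eq, mul_div_cancel₀ _ (two_ne_zero), add_mul, ← Real.exp_add, ← Real.exp_add]
        simp only [hg]
        congr 2 <;> ring
      have h2 : (l * (a - b) / 2) ^ 2 / 2 ≤ l ^ 2 * c ^ 2 / 8 := by
        have : (a - b) ^ 2 ≤ c ^ 2 := sq_le_sq.2 (hd.trans (le_abs_self c))
        nlinarith [mul_le_mul_of_nonneg_left this (sq_nonneg l)]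
      rw [h1]
      gcongr
      exact (Real.cosh_le_exp_half_sq _).trans (Real.exp_le_exp.2 h2)
    rw [split]
    calc _ ≤ ∑ ε, 2 * Real.exp (l ^ 2 * c ^ 2 / 8) * Real.exp (l * g ε) :=
          Finset.sum_le_sum fun ε _ => hstep ε
      _ = 2 * Real.exp (l ^ 2 * c ^ 2 / 8) * ∑ ε, Real.exp (l * g ε) := by rw [Finset.mul_sum]
      _ ≤ 2 * Real.exp (l ^ 2 * c ^ 2 / 8) *
          (2 ^ N * Real.exp (l * ((∑ ε, g ε) / 2 ^ N) + N * (l ^ 2 * c ^ 2 / 8))) := by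
          gcongr
          exact ih g hgd
      _ = _ := by
          rw [hmean, mul_mul_mul_comm, ← Real.exp_add, pow_succ' (2 : ℝ)]
          congr 2
          push_cast
          ring

/-- Among finitely many odd functions of signs with bounded differences, some choice of signs makes
all of them small simultaneously. -/
theorem exists_signs_abs_le {J : Type*} (I : Finset J) (N : ℕ) (p δ : ℝ) (hp : 0 < p)
    (hNp : N * p ≤ 1 / 2) (hI : 2 * (#I : ℝ) < Real.exp (δ ^ 2 / p)) (hδ : 0 < δ)
    (f : J → (Fin N → Bool) → ℝ)
    (hodd : ∀ j ε, f j (fun i => !ε i) = -f j ε)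
    (hf : ∀ j ε i, |f j ε - f j (Function.update ε i (!ε i))| ≤ 2 * p) :
    ∃ ε, ∀ j ∈ I, |f j ε| ≤ δ := by
  have hmean : ∀ j, ∑ ε, f j ε = 0 := by
    intro j
    have h : ∑ ε, f j ε = ∑ ε, -f j ε := by
      simp_rw [← hodd j]
      exact (Equiv.sum_comp (Equiv.piCongrRight fun _ => Equiv.boolNot) (f j)).symm
    rw [Finset.sum_neg_distrib] at h
    linarith
  set l := 2 * δ / p with hl
  have hmom : ∀ l' : ℝ, l' ^ 2 = l ^ 2 → ∀ j,
      ∑ ε, Real.exp (l' * f j ε) ≤ 2 ^ N * Real.exp (δ ^ 2 / p) := by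
    intro l' hl' j
    refine (sum_exp_le_of_bounded_differences (2 * p) N (f j) (hf j) l').trans ?_
    rw [hmean j, hl']
    gcongr
    have : (N : ℝ) * (l ^ 2 * (2 * p) ^ 2 / 8) = (N * p) * (2 * (δ ^ 2 / p)) := by
      rw [hl]; field_simp; ring
    have h0 : 0 ≤ δ ^ 2 / p := by positivity
    rw [zero_div, mul_zero, zero_add, this]
    nlinarith
  obtain ⟨ε, -, hε⟩ := Finset.exists_le_of_sum_le (s := (Finset.univ : Finset (Fin N → Bool)))
    (f := fun ε => ∑ j ∈ I, (Real.exp (l * f j ε) + Real.exp (-l * f j ε)))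
    (g := fun _ => 2 * (#I : ℝ) * Real.exp (δ ^ 2 / p)) Finset.univ_nonempty (by
      rw [Finset.sum_comm]
      refine (Finset.sum_le_sum (g := fun _ => 2 * (2 ^ N * Real.exp (δ ^ 2 / p)))
        fun j _ => ?_).trans_eq ?_
      · rw [Finset.sum_add_distrib, two_mul]
        exact add_le_add (hmom l rfl j) (hmom (-l) (neg_sq l) j)
      · simp
        ring)
  refine ⟨ε, fun j hj => ?_⟩
  have hlt : ∀ x : ℝ, Real.exp (l * x) ≤ 2 * (#I : ℝ) * Real.exp (δ ^ 2 / p) → x ≤ δ := by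
    intro x hx
    have h1 : Real.exp (l * x) < Real.exp (l * δ) := by
      refine hx.trans_lt ?_
      have : l * δ = δ ^ 2 / p + δ ^ 2 / p := by rw [hl]; ring
      rw [this, Real.exp_add]
      gcongr
    have hl0 : 0 < l := by positivity
    exact (lt_of_mul_lt_mul_left (Real.exp_lt_exp.1 h1) hl0.le).le
  have hle := (Finset.single_le_sum
    (f := fun j => Real.exp (l * f j ε) + Real.exp (-l * f j ε))
    (fun j _ => by positivity) hj).trans hε
  rw [abs_le']
  constructor
  · exact hlt _ (le_trans (by simp [Real.exp_nonneg]) hle)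
  · refine hlt _ (le_trans ?_ hle)
    rw [mul_neg, ← neg_mul]
    simp [Real.exp_nonneg]

/-- The part of the space left after removing the sets `C i` with `ε i = true`. -/
def carve {Ω : Type*} {N : ℕ} (C : Fin N → Set Ω) (ε : Fin N → Bool) : Set Ω :=
  {x | ∀ i, ε i = true → x ∉ C i}

theorem measurableSet_carve {Ω : Type*} [MeasurableSpace Ω] {N : ℕ} {C : Fin N → Set Ω}
    (hC : ∀ i, MeasurableSet (C i)) (ε : Fin N → Bool) : MeasurableSet (carve C ε) := by
  have : carve C ε = ⋂ i, ⋂ _ : ε i = true, (C i)ᶜ := by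
    ext x; simp [carve]
  rw [this]
  exact MeasurableSet.iInter fun i => MeasurableSet.iInter fun _ => (hC i).compl

theorem abs_measureReal_sub_le {Ω : Type*} [MeasurableSpace Ω] {μ : Measure Ω} [IsFiniteMeasure μ]
    {A B D : Set Ω} (h1 : A ⊆ B ∪ D) (h2 : B ⊆ A ∪ D) : |μ.real A - μ.real B| ≤ μ.real D := by
  have h3 := (measureReal_mono h1 (measure_ne_top μ _)).trans (measureReal_union_le B D)
  have h4 := (measureReal_mono h2 (measure_ne_top μ _)).trans (measureReal_union_le A D)
  rw [abs_le]
  constructor <;> linarith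

theorem abs_measureReal_carve_sub_le {Ω : Type*} [MeasurableSpace Ω] {μ : Measure Ω}
    [IsFiniteMeasure μ] {N : ℕ} (C : Fin N → Set Ω) (H : Set Ω) {ε ε' : Fin N → Bool} (i : Fin N)
    (h : ∀ j, j ≠ i → ε j = ε' j) :
    |μ.real (carve C ε ∩ H) - μ.real (carve C ε' ∩ H)| ≤ μ.real (C i) := by
  have key : ∀ {ε ε' : Fin N → Bool}, (∀ j, j ≠ i → ε j = ε' j) →
      carve C ε ∩ H ⊆ carve C ε' ∩ H ∪ C i := by
    intro ε ε' h x hx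
    by_cases hxi : x ∈ C i
    · exact Or.inr hxi
    · refine Or.inl ⟨fun j hj => ?_, hx.2⟩
      by_cases hji : j = i
      · rwa [hji]
      · exact hx.1 j (by rw [h j hji, hj])
  exact abs_measureReal_sub_le (key h) (key fun j hj => (h j hj).symm)

theorem exists_carve_close {Ω J : Type*} [MeasurableSpace Ω] {μ : Measure Ω} [IsFiniteMeasure μ]
    {N : ℕ} (C : Fin N → Set Ω) (I : Finset J) (H : J → Set Ω) (p δ : ℝ) (hp : 0 < p)
    (hCp : ∀ i, μ.real (C i) = p) (hNp : N * p ≤ 1 / 2)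
    (hI : 2 * (#I : ℝ) < Real.exp (δ ^ 2 / p)) (hδ : 0 < δ) :
    ∃ ε : Fin N → Bool, ∀ j ∈ I,
      |μ.real (carve C ε ∩ H j) - μ.real (carve C (fun i => !ε i) ∩ H j)| ≤ δ := by
  refine exists_signs_abs_le I N p δ hp hNp hI hδ
    (fun j ε => μ.real (carve C ε ∩ H j) - μ.real (carve C (fun i => !ε i) ∩ H j)) ?_ ?_
  · intro j ε
    simp
  · intro j ε i
    have h1 := abs_measureReal_carve_sub_le (μ := μ) C (H j) (ε := ε)
      (ε' := Function.update ε i (!ε i)) i (fun j' hj' => by simp [hj'])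
    have h2 := abs_measureReal_carve_sub_le (μ := μ) C (H j) (ε := fun i => !ε i)
      (ε' := fun i' => !(Function.update ε i (!ε i) i')) i (fun j' hj' => by simp [hj'])
    rw [hCp, abs_le] at h1 h2
    rw [abs_le]
    constructor <;> linarith [h1.1, h1.2, h2.1, h2.2]

theorem le_measureReal_carve_diff_add {Ω : Type*} [MeasurableSpace Ω] {μ : Measure Ω}
    [IsFiniteMeasure μ] {N : ℕ} (C : Fin N → Set Ω) (hC : ∀ i, MeasurableSet (C i))
    (ε : Fin N → Bool) :
    ∑ i, μ.real (C i) - ∑ i, ∑ j, (if i = j then 0 else μ.real (C i ∩ C j)) ≤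
      μ.real (carve C ε \ carve C (fun i => !ε i)) +
        μ.real (carve C (fun i => !ε i) \ carve C ε) := by
  set E : Fin N → Set Ω := fun i => C i \ ⋃ j, ⋃ _ : i ≠ j, C j with hE
  have hEm : ∀ i, MeasurableSet (E i) := fun i =>
    (hC i).diff (MeasurableSet.iUnion fun j => MeasurableSet.iUnion fun _ => hC j)
  have hdisj : ((Finset.univ : Finset (Fin N)) : Set (Fin N)).PairwiseDisjoint E := by
    intro i _ j _ hij
    refine Set.disjoint_left.2 fun x hxi hxj => hxi.2 ?_
    simp only [Set.mem_iUnion]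
    exact ⟨j, hij, hxj.1⟩
  have hlow : ∀ i, μ.real (C i) - ∑ j, (if i = j then 0 else μ.real (C i ∩ C j)) ≤
      μ.real (E i) := by
    intro i
    have hsub : C i ⊆ E i ∪ ⋃ j ∈ (Finset.univ : Finset (Fin N)),
        (if i = j then ∅ else C i ∩ C j) := by
      intro x hx
      by_cases h : x ∈ E i
      · exact Or.inl h
      · right
        have : ∃ j, i ≠ j ∧ x ∈ C j := by
          by_contra hcon
          refine h ⟨hx, ?_⟩
          simpa using hcon
        obtain ⟨j, hij, hxj⟩ := this
        simp only [Set.mem_iUnion]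
        exact ⟨j, Finset.mem_univ j, by rw [if_neg hij]; exact ⟨hx, hxj⟩⟩
    have h1 := (measureReal_mono hsub (measure_ne_top μ _)).trans (measureReal_union_le _ _)
    have h2 := measureReal_biUnion_finset_le (μ := μ) (Finset.univ : Finset (Fin N))
      (fun j => if i = j then ∅ else C i ∩ C j)
    have h3 : ∀ j, μ.real (if i = j then ∅ else C i ∩ C j) =
        if i = j then 0 else μ.real (C i ∩ C j) := by
      intro j
      split_ifs <;> simp
    simp only [h3] at h2
    linarith
  have hEsub : (⋃ i ∈ (Finset.univ : Finset (Fin N)), E i) ⊆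
      (carve C ε \ carve C (fun i => !ε i)) ∪ (carve C (fun i => !ε i) \ carve C ε) := by
    intro x hx
    simp only [Set.mem_iUnion] at hx
    obtain ⟨i, -, hxi, hx'⟩ := hx
    have huniq : ∀ j, x ∈ C j → j = i := by
      intro j hj
      by_contra hne
      apply hx'
      simp only [Set.mem_iUnion]
      exact ⟨j, fun h => hne h.symm, hj⟩
    cases h : ε i
    · refine Or.inl ⟨fun j hj hxj => ?_, fun hcon => hcon i (by simp [h]) hxi⟩
      rw [huniq j hxj, h] at hj
      exact Bool.noConfusion hj
    · refine Or.inr ⟨fun j hj hxj => ?_, fun hcon => hcon i h hxi⟩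
      simp [huniq j hxj, h] at hj
  have h1 := measureReal_biUnion_finset (μ := μ) hdisj (fun i _ => hEm i)
  have h2 := (measureReal_mono hEsub (measure_ne_top μ _)).trans (measureReal_union_le _ _)
  have h3 := Finset.sum_le_sum fun i (_ : i ∈ Finset.univ) => hlow i
  rw [Finset.sum_sub_distrib] at h3
  linarith

/-- A greedy choice of a sequence with small total pairwise interaction. -/
theorem exists_seq_sum_le {A : Type*} [Fintype A] [Nonempty A] (F : A → A → ℝ)
    (hsymm : ∀ a b, F a b = F b a) (c : ℝ) (hc : 0 ≤ c)
    (hF : ∀ a, ∑ b, F a b ≤ Fintype.card A * c) (n : ℕ) :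
    ∃ φ : ℕ → A, ∑ i ∈ range n, ∑ j ∈ range n, (if i = j then 0 else F (φ i) (φ j)) ≤
      n ^ 2 * c := by
  induction n with
  | zero => exact ⟨fun _ => Classical.arbitrary A, by simp⟩
  | succ n ih =>
    obtain ⟨φ, hφ⟩ := ih
    obtain ⟨b, -, hb⟩ := Finset.exists_le_of_sum_le (s := (Finset.univ : Finset A))
      (f := fun b => ∑ i ∈ range n, F (φ i) b) (g := fun _ => n * c) Finset.univ_nonempty (by
        rw [Finset.sum_comm]
        refine (Finset.sum_le_sum fun i _ => hF (φ i)).trans_eq ?_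
        simp
        ring)
    refine ⟨Function.update φ n b, ?_⟩
    have hu : ∀ i ∈ range n, Function.update φ n b i = φ i := fun i hi =>
      Function.update_of_ne (Finset.mem_range.1 hi).ne _ _
    have hne : ∀ i ∈ range n, i ≠ n := fun i hi => (Finset.mem_range.1 hi).ne
    have h1 : ∑ i ∈ range n, ∑ j ∈ range n, (if i = j then 0 else
        F (Function.update φ n b i) (Function.update φ n b j)) =
        ∑ i ∈ range n, ∑ j ∈ range n, (if i = j then 0 else F (φ i) (φ j)) :=
      Finset.sum_congr rfl fun i hi => Finset.sum_congr rfl fun j hj => by rw [hu i hi, hu j hj]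
    have h2 : ∑ i ∈ range n, (if i = n then 0 else
        F (Function.update φ n b i) (Function.update φ n b n)) = ∑ i ∈ range n, F (φ i) b :=
      Finset.sum_congr rfl fun i hi => by
        rw [if_neg (hne i hi), hu i hi, Function.update_self]
    have h3 : ∑ j ∈ range n, (if n = j then 0 else
        F (Function.update φ n b n) (Function.update φ n b j)) = ∑ i ∈ range n, F (φ i) b :=
      Finset.sum_congr rfl fun j hj => by
        rw [if_neg (hne j hj).symm, hu j hj, Function.update_self, hsymm]
    rw [Finset.sum_range_succ]
    simp_rw [Finset.sum_range_succ _ n]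
    rw [Finset.sum_add_distrib, h1, h2, h3, if_pos trivial]
    push_cast
    nlinarith

/-- The uniform probability measure on the unit cube. -/
noncomputable def cubeMeasure (ι : Type*) [Fintype ι] : Measure (ι → ℝ) :=
  Measure.pi fun _ => volume.restrict (Set.Icc 0 1)

theorem isProbabilityMeasure_restrict_Icc :
    IsProbabilityMeasure ((volume : Measure ℝ).restrict (Set.Icc 0 1)) :=
  ⟨by simp⟩

instance (ι : Type*) [Fintype ι] : IsProbabilityMeasure (cubeMeasure ι) := by
  have := isProbabilityMeasure_restrict_Icc
  unfold cubeMeasure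
  infer_instance

theorem cubeMeasure_eq (ι : Type*) [Fintype ι] :
    cubeMeasure ι = (volume : Measure (ι → ℝ)).restrict (Set.Icc 0 1) := by
  rw [cubeMeasure, ← Measure.restrict_pi_pi, Set.pi_univ_Icc, volume_pi]
  rfl

theorem cubeMeasure_real_eq {ι : Type*} [Fintype ι] {A : Set (ι → ℝ)} (hA : A ⊆ Set.Icc 0 1) :
    (cubeMeasure ι).real A = volume.real A := by
  rw [cubeMeasure_eq, measureReal_def, Measure.restrict_apply' measurableSet_Icc,
    Set.inter_eq_left.2 hA, measureReal_def]

theorem cubeMeasure_real_inter {ι : Type*} [Fintype ι] (A : Set (ι → ℝ)) :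
    (cubeMeasure ι).real (A ∩ Set.Icc 0 1) = (cubeMeasure ι).real A := by
  rw [cubeMeasure_eq, measureReal_def, measureReal_def,
    Measure.restrict_apply' measurableSet_Icc, Measure.restrict_apply' measurableSet_Icc,
    Set.inter_assoc, Set.inter_self]

theorem iIndepFun_eval_cubeMeasure (ι : Type*) [Fintype ι] :
    ProbabilityTheory.iIndepFun (fun (i : ι) (x : ι → ℝ) => x i) (cubeMeasure ι) := by
  have := isProbabilityMeasure_restrict_Icc
  exact ProbabilityTheory.iIndepFun_pi (X := fun _ => id) fun _ => aemeasurable_id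

theorem map_eval_cubeMeasure {ι : Type*} [Fintype ι] (i : ι) :
    (cubeMeasure ι).map (fun x => x i) = volume.restrict (Set.Icc 0 1) := by
  have := isProbabilityMeasure_restrict_Icc
  exact (measurePreserving_eval (fun _ : ι => (volume : Measure ℝ).restrict (Set.Icc 0 1)) i).map_eq

theorem map_comp_cubeMeasure {ι κ : Type*} [Fintype ι] [Fintype κ] {g : κ → ι}
    (hg : Function.Injective g) :
    (cubeMeasure ι).map (fun x j => x (g j)) = cubeMeasure κ := by
  have h := (ProbabilityTheory.iIndepFun_iff_map_fun_eq_pi_map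
    (fun j => (measurable_pi_apply (g j)).aemeasurable)).1
    ((iIndepFun_eval_cubeMeasure ι).precomp hg)
  rw [h]
  simp_rw [map_eval_cubeMeasure]
  rfl

theorem indepFun_comp_cubeMeasure {ι κ κ' : Type*} [Fintype ι] [Fintype κ] [Fintype κ']
    (g : κ → ι) (h : κ' → ι) (hgh : ∀ j j', g j ≠ h j') :
    ProbabilityTheory.IndepFun (fun (x : ι → ℝ) j => x (g j)) (fun (x : ι → ℝ) j => x (h j))
      (cubeMeasure ι) := by
  classical
  have hd : Disjoint (Finset.univ.image g) (Finset.univ.image h) := by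
    rw [Finset.disjoint_left]
    intro i hi hi'
    obtain ⟨j, -, rfl⟩ := Finset.mem_image.1 hi
    obtain ⟨j', -, hj'⟩ := Finset.mem_image.1 hi'
    exact hgh j j' hj'.symm
  have := (iIndepFun_eval_cubeMeasure ι).indepFun_finset _ _ hd (fun i => measurable_pi_apply i)
  exact this.comp
    (φ := fun (y : (Finset.univ.image g) → ℝ) j =>
      y ⟨g j, Finset.mem_image_of_mem g (Finset.mem_univ j)⟩)
    (ψ := fun (y : (Finset.univ.image h) → ℝ) j =>
      y ⟨h j, Finset.mem_image_of_mem h (Finset.mem_univ j)⟩)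
    (measurable_pi_lambda _ fun j => measurable_pi_apply _)
    (measurable_pi_lambda _ fun j => measurable_pi_apply _)

/-- The corner of the unit cube at the all-ones vertex, cut off by a hyperplane orthogonal to the
main diagonal. -/
def corner (κ : Type*) [Fintype κ] (s : ℝ) : Set (κ → ℝ) :=
  {x | Fintype.card κ - s < ∑ j, x j}

theorem measurableSet_corner (κ : Type*) [Fintype κ] (s : ℝ) : MeasurableSet (corner κ s) :=
  measurableSet_lt measurable_const (by fun_prop)

theorem one_sub_lt_of_mem_corner {κ : Type*} [Fintype κ] {s : ℝ} {x : κ → ℝ}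
    (hx : x ∈ corner κ s) (hx1 : ∀ j, x j ≤ 1) (j : κ) : 1 - s < x j := by
  have h : ∑ i, (1 - x i) < s := by
    have : (Fintype.card κ : ℝ) - s < ∑ j, x j := hx
    simp
    linarith
  have := (Finset.single_le_sum (f := fun i => 1 - x i)
    (fun i _ => sub_nonneg.2 (hx1 i)) (Finset.mem_univ j)).trans_lt h
  linarith

theorem cubeMeasure_real_box {κ : Type*} [Fintype κ] {s : ℝ} (hs0 : 0 ≤ s) (hs1 : s ≤ 1) :
    (cubeMeasure κ).real {x | ∀ j, 1 - s < x j} = s ^ Fintype.card κ := by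
  have : {x : κ → ℝ | ∀ j, 1 - s < x j} = Set.univ.pi fun _ => Set.Ioi (1 - s) := by
    ext x; simp
  have := isProbabilityMeasure_restrict_Icc
  have h2 : Set.Ioi (1 - s) ∩ Set.Icc 0 1 = Set.Ioc (1 - s) 1 := by
    ext y
    simp only [Set.mem_inter_iff, Set.mem_Ioi, Set.mem_Icc, Set.mem_Ioc]
    constructor
    · rintro ⟨h, -, h'⟩; exact ⟨h, h'⟩
    · rintro ⟨h, h'⟩; exact ⟨h, by linarith, h'⟩
  rw [‹{x : κ → ℝ | ∀ j, 1 - s < x j} = _›, measureReal_def, cubeMeasure, Measure.pi_pi]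
  simp [h2, hs0]

theorem cubeMeasure_real_corner_le (κ : Type*) [Fintype κ] {s : ℝ} (hs0 : 0 ≤ s) (hs1 : s ≤ 1) :
    (cubeMeasure κ).real (corner κ s) ≤ s ^ Fintype.card κ := by
  rw [← cubeMeasure_real_inter, ← cubeMeasure_real_box hs0 hs1]
  exact measureReal_mono fun x hx j => one_sub_lt_of_mem_corner hx.1 hx.2.2 j

theorem le_cubeMeasure_real_corner (κ : Type*) [Fintype κ] [Nonempty κ] {s : ℝ} (hs0 : 0 ≤ s)
    (hs1 : s ≤ 1) :
    (s / Fintype.card κ) ^ Fintype.card κ ≤ (cubeMeasure κ).real (corner κ s) := by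
  have hk : (0 : ℝ) < Fintype.card κ := by exact_mod_cast Fintype.card_pos
  have hk1 : (1 : ℝ) ≤ Fintype.card κ := by exact_mod_cast Fintype.card_pos
  rw [← cubeMeasure_real_box (s := s / Fintype.card κ) (by positivity)
    ((div_le_self hs0 hk1).trans hs1)]
  refine measureReal_mono fun x hx => ?_
  have := Finset.sum_lt_sum_of_nonempty (Finset.univ_nonempty (α := κ)) fun j _ => hx j
  simp only [Finset.sum_const, Finset.card_univ, nsmul_eq_mul, mul_sub, mul_one,
    mul_div_cancel₀ _ hk.ne'] at this
  exact this

/-- The part of space cut off by the halfspace bounding the sum of one coordinate from each of `k`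
blocks, the coordinates being selected by `S`. -/
def cap {ι : Type*} {k m : ℕ} (e : Fin k × Fin m → ι) (s : ℝ) (S : Fin k → Fin m) :
    Set (ι → ℝ) :=
  {x | k - s < ∑ j, x (e (j, S j))}

section Cap

variable {ι : Type*} {k m : ℕ} {e : Fin k × Fin m → ι} {s : ℝ}

theorem cap_eq_preimage (S : Fin k → Fin m) :
    cap e s S = (fun (x : ι → ℝ) j => x (e (j, S j))) ⁻¹' corner (Fin k) s := by
  ext x
  simp [cap, corner]

theorem measurableSet_cap (S : Fin k → Fin m) : MeasurableSet (cap e s S) := by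
  rw [cap_eq_preimage]
  exact measurableSet_preimage (by fun_prop) (measurableSet_corner _ _)

theorem cubeMeasure_real_cap [Fintype ι] (he : Function.Injective e) (S : Fin k → Fin m) :
    (cubeMeasure ι).real (cap e s S) = (cubeMeasure (Fin k)).real (corner (Fin k) s) := by
  have hg : Function.Injective fun j => e (j, S j) := fun j j' h => (Prod.ext_iff.1 (he h)).1
  rw [cap_eq_preimage, ← map_comp_cubeMeasure hg,
    map_measureReal_apply (by fun_prop) (measurableSet_corner _ _)]

theorem cubeMeasure_real_cap_inter_le [Fintype ι] (he : Function.Injective e) (hk : 1 ≤ k)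
    (hs0 : 0 < s) (hs1 : s ≤ 1) (S T : Fin k → Fin m) :
    (cubeMeasure ι).real (cap e s S ∩ cap e s T) ≤
      (cubeMeasure (Fin k)).real (corner (Fin k) s) ^ 2 *
        ∏ j, (if T j = S j then (k : ℝ) ^ k / s else 1) := by
  set p := (cubeMeasure (Fin k)).real (corner (Fin k) s) with hp
  have : Nonempty (Fin k) := ⟨⟨0, hk⟩⟩
  have hp0 : (s / k) ^ k ≤ p := by
    simpa using le_cubeMeasure_real_corner (Fin k) hs0.le hs1
  have hk0 : (0 : ℝ) < k := by exact_mod_cast hk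
  by_cases hD : ∀ j, T j ≠ S j
  · have hind := indepFun_comp_cubeMeasure (fun j => e (j, S j)) (fun j => e (j, T j))
      (fun j j' h => by
        obtain ⟨h1, h2⟩ := Prod.ext_iff.1 (he h)
        simp only at h1 h2
        subst h1
        exact hD j h2.symm)
    have hmul := hind.measure_inter_preimage_eq_mul _ _ (measurableSet_corner (Fin k) s)
      (measurableSet_corner (Fin k) s)
    rw [← cap_eq_preimage, ← cap_eq_preimage] at hmul
    rw [measureReal_def, hmul, ENNReal.toReal_mul, ← measureReal_def, ← measureReal_def,
      cubeMeasure_real_cap he, cubeMeasure_real_cap he, Finset.prod_eq_one fun j _ => if_neg (hD j),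
      mul_one, sq]
  · obtain ⟨j₀, hj₀⟩ : ∃ j, T j = S j := by
      by_contra hcon
      exact hD fun j hj => hcon ⟨j, hj⟩
    have hind := indepFun_comp_cubeMeasure (fun j => e (j, S j))
      (fun j : {j // ¬ T j = S j} => e (j, T j))
      (fun j j' h => by
        obtain ⟨h1, h2⟩ := Prod.ext_iff.1 (he h)
        simp only at h1 h2
        subst h1
        exact j'.2 h2.symm)
    have hmeas : MeasurableSet {x : {j // ¬ T j = S j} → ℝ | ∀ j, 1 - s < x j} := by
      rw [Set.ofPred_forall]
      exact MeasurableSet.iInter fun j => measurableSet_lt measurable_const (measurable_pi_apply j)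
    have hmul := hind.measure_inter_preimage_eq_mul _ _ (measurableSet_corner (Fin k) s) hmeas
    have hinj : Function.Injective fun j : {j // ¬ T j = S j} => e (j, T j) :=
      fun j j' h => Subtype.ext (Prod.ext_iff.1 (he h)).1
    have hbox : (cubeMeasure ι).real ((fun (x : ι → ℝ) (j : {j // ¬ T j = S j}) => x (e (j, T j)))
        ⁻¹' {x | ∀ j, 1 - s < x j}) = s ^ Fintype.card {j // ¬ T j = S j} := by
      rw [← cubeMeasure_real_box hs0.le hs1, ← map_comp_cubeMeasure hinj,
        map_measureReal_apply (by fun_prop) hmeas]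
    have hle : (cubeMeasure ι).real (cap e s S ∩ cap e s T) ≤
        p * s ^ Fintype.card {j // ¬ T j = S j} := by
      rw [← hbox, hp, ← cubeMeasure_real_cap he S, measureReal_def (cubeMeasure ι) (cap e s S),
        cap_eq_preimage S, measureReal_def, measureReal_def, ← ENNReal.toReal_mul, ← hmul,
        ← measureReal_def, ← measureReal_def, ← cap_eq_preimage, ← cubeMeasure_real_inter]
      refine measureReal_mono fun x hx => ⟨?_, fun j => ?_⟩
      · exact hx.1.1
      · have := hx.1.2
        rw [cap_eq_preimage] at this
        exact one_sub_lt_of_mem_corner this (fun j => hx.2.2 _) j.1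
    refine hle.trans ?_
    have hprod : ∏ j, (if T j = S j then (k : ℝ) ^ k / s else 1) =
        ((k : ℝ) ^ k / s) ^ Fintype.card {j // T j = S j} := by
      rw [Finset.prod_ite]
      simp [Fintype.card_subtype, div_pow]
    have hcard : Fintype.card {j // T j = S j} + Fintype.card {j // ¬ T j = S j} = k := by
      have := Fintype.card_subtype_compl (fun j => T j = S j)
      have h2 := Fintype.card_subtype_le (fun j => T j = S j)
      simp only [Fintype.card_fin] at this h2
      omega
    have hl : 1 ≤ Fintype.card {j // T j = S j} := Fintype.card_pos_iff.2 ⟨⟨j₀, hj₀⟩⟩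
    rw [hprod, sq, mul_assoc]
    have hp00 : 0 ≤ p := measureReal_nonneg
    refine mul_le_mul_of_nonneg_left ?_ hp00
    generalize Fintype.card {j // T j = S j} = l at hcard hl
    generalize Fintype.card {j // ¬ T j = S j} = r at hcard
    have hK : (1 : ℝ) ≤ (k : ℝ) ^ k := one_le_pow₀ (by exact_mod_cast hk)
    have hKl : (k : ℝ) ^ k ≤ ((k : ℝ) ^ k) ^ l := le_self_pow₀ hK (by omega)
    calc s ^ r = (s ^ l * s ^ r) / (k : ℝ) ^ k * ((k : ℝ) ^ k / s ^ l) := by field_simp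
      _ = (s / k) ^ k * ((k : ℝ) ^ k / s ^ l) := by rw [← pow_add, hcard, div_pow]
      _ ≤ p * (((k : ℝ) ^ k) ^ l / s ^ l) := by gcongr
      _ = p * ((k : ℝ) ^ k / s) ^ l := by rw [div_pow]

theorem sum_cubeMeasure_real_cap_inter_le [Fintype ι] (he : Function.Injective e) (hk : 1 ≤ k)
    (hs0 : 0 < s) (hs1 : s ≤ 1) (hm : 1 ≤ m) (S : Fin k → Fin m) :
    ∑ T, (cubeMeasure ι).real (cap e s S ∩ cap e s T) ≤
      Fintype.card (Fin k → Fin m) *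
        ((cubeMeasure (Fin k)).real (corner (Fin k) s) ^ 2 * (1 + (k : ℝ) ^ k / (s * m)) ^ k) := by
  set p := (cubeMeasure (Fin k)).real (corner (Fin k) s)
  have hm0 : (0 : ℝ) < m := by exact_mod_cast hm
  calc _ ≤ ∑ T : Fin k → Fin m, p ^ 2 * ∏ j, (if T j = S j then (k : ℝ) ^ k / s else 1) :=
        Finset.sum_le_sum fun T _ => cubeMeasure_real_cap_inter_le he hk hs0 hs1 S T
    _ = p ^ 2 * ∏ j : Fin k, ∑ i : Fin m, (if i = S j then (k : ℝ) ^ k / s else 1) := by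
        rw [← Finset.mul_sum, Finset.prod_univ_sum, Fintype.piFinset_univ]
    _ ≤ p ^ 2 * ∏ j : Fin k, (m * (1 + (k : ℝ) ^ k / (s * m))) := by
        refine mul_le_mul_of_nonneg_left (Finset.prod_le_prod (fun j _ => ?_) fun j _ => ?_)
          (sq_nonneg _)
        · exact Finset.sum_nonneg fun i _ => by split_ifs <;> positivity
        · calc _ ≤ ∑ i : Fin m, ((if i = S j then (k : ℝ) ^ k / s else 0) + 1) :=
                Finset.sum_le_sum fun i _ => by split_ifs <;> simp
            _ = (k : ℝ) ^ k / s + m := by rw [Finset.sum_add_distrib]; simp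
            _ = _ := by field_simp; ring
    _ = _ := by
        simp [mul_pow]
        ring

end Cap

theorem cubeMeasure_real_slab_le {ι : Type*} [Fintype ι] (c : ι → ℝ) (i₀ : ι) (hc : c i₀ ≠ 0)
    (α w : ℝ) (hw : 0 ≤ w) :
    (cubeMeasure ι).real {x | ∑ i, c i * x i ∈ Set.Ioc α (α + w)} ≤ w / |c i₀| := by
  classical
  set Y : (ι → ℝ) → ℝ := fun x => ∑ i : {i // i ≠ i₀}, c i * x i with hY
  have hYm : Measurable Y := by fun_prop
  have hXm : Measurable fun x : ι → ℝ => x i₀ := by fun_prop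
  have hind : ProbabilityTheory.IndepFun Y (fun x => x i₀) (cubeMeasure ι) := by
    have := indepFun_comp_cubeMeasure (fun i : {i // i ≠ i₀} => (i : ι)) (fun _ : Unit => i₀)
      (fun i _ => i.2)
    have hφ : Measurable fun y : {i // i ≠ i₀} → ℝ => ∑ i : {i // i ≠ i₀}, c i * y i := by fun_prop
    have hψ : Measurable fun y : Unit → ℝ => y () := measurable_pi_apply ()
    exact this.comp hφ hψ
  have hmap := (ProbabilityTheory.indepFun_iff_map_prod_eq_prod_map_map hYm.aemeasurable
    hXm.aemeasurable).1 hind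
  have hset : {x : ι → ℝ | ∑ i, c i * x i ∈ Set.Ioc α (α + w)} =
      (fun x => (Y x, x i₀)) ⁻¹' {z : ℝ × ℝ | c i₀ * z.2 + z.1 ∈ Set.Ioc α (α + w)} := by
    ext x
    simp only [Set.mem_ofPred_eq, Set.mem_preimage, hY]
    rw [Fintype.sum_eq_add_sum_subtype_ne (fun i => c i * x i) i₀]
  have hZm : MeasurableSet {z : ℝ × ℝ | c i₀ * z.2 + z.1 ∈ Set.Ioc α (α + w)} :=
    measurableSet_preimage (f := fun z : ℝ × ℝ => c i₀ * z.2 + z.1) (by fun_prop)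
      measurableSet_Ioc
  have := isProbabilityMeasure_restrict_Icc
  have hYp : IsProbabilityMeasure ((cubeMeasure ι).map Y) :=
    Measure.isProbabilityMeasure_map hYm.aemeasurable
  have hbound : (cubeMeasure ι) {x | ∑ i, c i * x i ∈ Set.Ioc α (α + w)} ≤
      ENNReal.ofReal (w / |c i₀|) := by
    rw [hset, ← Measure.map_apply (hYm.prodMk hXm) hZm, hmap, map_eval_cubeMeasure,
      Measure.prod_apply hZm]
    calc _ ≤ ∫⁻ _, ENNReal.ofReal (w / |c i₀|) ∂((cubeMeasure ι).map Y) := by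
          refine lintegral_mono fun y => ?_
          refine (Measure.restrict_apply_le _ _).trans ?_
          have : Prod.mk y ⁻¹' {z : ℝ × ℝ | c i₀ * z.2 + z.1 ∈ Set.Ioc α (α + w)} =
              (fun x => c i₀ * x) ⁻¹' Set.Ioc (α - y) (α + w - y) := by
            ext x
            simp [sub_lt_iff_lt_add, le_sub_iff_add_le]
          rw [this, Real.volume_preimage_mul_left hc, Real.volume_Ioc,
            ← ENNReal.ofReal_mul (abs_nonneg _), abs_inv]
          refine ENNReal.ofReal_le_ofReal (le_of_eq ?_)
          rw [div_eq_inv_mul]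
          ring
      _ = _ := by simp
  exact ENNReal.toReal_le_of_le_ofReal (by positivity) hbound

/-- A finite family of integral halfspaces that approximates all halfspaces on the unit cube. -/
noncomputable def halfspaceNet (d M : ℕ) : Finset ((Fin d → ℤ) × ℤ) :=
  (Fintype.piFinset fun _ => Finset.Icc (-(M : ℤ)) M) ×ˢ
    Finset.Icc (-(M * d + d : ℤ)) (M * d + 1)

theorem card_halfspaceNet (d M : ℕ) :
    #(halfspaceNet d M) = (2 * M + 1) ^ d * (2 * M * d + d + 2) := by
  rw [halfspaceNet, Finset.card_product, Fintype.card_piFinset_const, Int.card_Icc, Int.card_Icc]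
  congr 2
  · omega
  · have : ((M * d + 1 + 1 - -(M * d + d) : ℤ)) = ((2 * M * d + d + 2 : ℕ) : ℤ) := by
      push_cast; ring
    rw [this, Int.toNat_natCast]

theorem zero_mem_halfspaceNet (d M : ℕ) : (0, 0) ∈ halfspaceNet d M := by
  simp only [halfspaceNet, Finset.mem_product, Fintype.mem_piFinset, Finset.mem_Icc]
  exact ⟨fun _ => ⟨neg_nonpos.2 (by positivity), by simp⟩, neg_nonpos.2 (by positivity),
    by positivity⟩

theorem measureReal_le_of_halfspaceNet_of_normalized {d M : ℕ} (hM : 1 ≤ M) {A B : Set (Fin d → ℝ)}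
    (hA : A ⊆ Set.Icc 0 1) (hB : B ⊆ Set.Icc 0 1) {δ : ℝ}
    (h : ∀ q ∈ halfspaceNet d M, |(cubeMeasure (Fin d)).real (A ∩ {x | ∑ i, (q.1 i : ℝ) * x i ≤ q.2})
      - (cubeMeasure (Fin d)).real (B ∩ {x | ∑ i, (q.1 i : ℝ) * x i ≤ q.2})| ≤ δ)
    (a : Fin d → ℝ) (b : ℝ) (i₀ : Fin d) (ha : ∀ i, |a i| ≤ M) (hi₀ : |a i₀| = M) :
    (cubeMeasure (Fin d)).real (A ∩ {x | ∑ i, a i * x i ≤ b}) ≤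
      (cubeMeasure (Fin d)).real (B ∩ {x | ∑ i, a i * x i ≤ b}) + (δ + (d + 1) / M) := by
  set μ := cubeMeasure (Fin d)
  have hM0 : (0 : ℝ) < M := by exact_mod_cast hM
  have hδ : |μ.real A - μ.real B| ≤ δ := by
    have h0 := h (0, 0) (zero_mem_halfspaceNet d M)
    simpa using h0
  have hδ0 : 0 ≤ δ := (abs_nonneg _).trans hδ
  have hbd : ∀ x ∈ Set.Icc (0 : Fin d → ℝ) 1, |∑ i, a i * x i| ≤ M * d := by
    intro x hx
    calc |∑ i, a i * x i| ≤ ∑ i, |a i * x i| := Finset.abs_sum_le_sum_abs _ _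
      _ ≤ ∑ _i : Fin d, (M : ℝ) := Finset.sum_le_sum fun i _ => by
          rw [abs_mul, abs_of_nonneg (hx.1 i)]
          exact (mul_le_of_le_one_right (abs_nonneg _) (hx.2 i)).trans (ha i)
      _ = M * d := by simp [mul_comm]
  by_cases hb1 : b < -(M * d)
  · have : A ∩ {x | ∑ i, a i * x i ≤ b} = ∅ := by
      refine Set.eq_empty_iff_forall_notMem.2 fun x hx => ?_
      have h1 := (abs_le.1 (hbd x (hA hx.1))).1
      have h2 : ∑ i, a i * x i ≤ b := hx.2
      linarith
    rw [this, measureReal_empty]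
    positivity
  by_cases hb2 : M * d ≤ b
  · have hfull : ∀ D : Set (Fin d → ℝ), D ⊆ Set.Icc 0 1 → D ∩ {x | ∑ i, a i * x i ≤ b} = D := by
      intro D hD
      refine Set.inter_eq_left.2 fun x hx => ?_
      exact ((abs_le.1 (hbd x (hD hx))).2.trans hb2 : ∑ i, a i * x i ≤ b)
    rw [hfull A hA, hfull B hB]
    have : (0 : ℝ) ≤ (d + 1) / M := by positivity
    linarith [(abs_le.1 hδ).2]
  push Not at hb1 hb2
  set c : Fin d → ℤ := fun i => ⌊a i⌋ with hc
  have hcM : |(c i₀ : ℝ)| = M := by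
    rcases abs_eq hM0.le |>.1 hi₀ with h1 | h1
    · simp [hc, h1]
    · have : c i₀ = -(M : ℤ) := by
        simp only [hc, h1]
        rw [show (-(M : ℝ)) = ((-(M : ℤ) : ℤ) : ℝ) by push_cast; rfl, Int.floor_intCast]
      rw [this]
      simp
  have hcx : ∀ x ∈ Set.Icc (0 : Fin d → ℝ) 1,
      ∑ i, (c i : ℝ) * x i ≤ ∑ i, a i * x i ∧ ∑ i, a i * x i ≤ ∑ i, (c i : ℝ) * x i + d := by
    intro x hx
    constructor
    · exact Finset.sum_le_sum fun i _ =>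
        mul_le_mul_of_nonneg_right (Int.floor_le (a i)) (hx.1 i)
    · calc ∑ i, a i * x i ≤ ∑ i, ((c i : ℝ) * x i + 1) := Finset.sum_le_sum fun i _ => by
            have h1 := (Int.lt_floor_add_one (a i)).le
            have h2 := mul_le_mul_of_nonneg_right h1 (hx.1 i)
            have h3 : x i ≤ 1 := hx.2 i
            simp only [hc]
            linarith
        _ = _ := by rw [Finset.sum_add_distrib]; simp
  set β : ℤ := ⌊b⌋ with hβ
  have hβ1 : (β : ℝ) ≤ b := Int.floor_le b
  have hβ2 : b < β + 1 := Int.lt_floor_add_one b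
  have hmem : (c, β + 1) ∈ halfspaceNet d M := by
    simp only [halfspaceNet, Finset.mem_product, Fintype.mem_piFinset, Finset.mem_Icc]
    refine ⟨fun i => ⟨Int.le_floor.2 ?_, ?_⟩, ?_, ?_⟩
    · push_cast
      exact (abs_le.1 (ha i)).1
    · have h1 : (c i : ℝ) ≤ M := (Int.floor_le _).trans (abs_le.1 (ha i)).2
      exact_mod_cast h1
    · have h1 : (-(M * d) : ℤ) ≤ β := Int.le_floor.2 (by push_cast; exact hb1)
      omega
    · have h1 : (β : ℝ) ≤ M * d := hβ1.trans hb2.le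
      have h2 : β ≤ M * d := by exact_mod_cast h1
      omega
  have hnet := h _ hmem
  have h1 : μ.real (A ∩ {x | ∑ i, a i * x i ≤ b}) ≤
      μ.real (A ∩ {x | ∑ i, (c i : ℝ) * x i ≤ ((β + 1 : ℤ) : ℝ)}) := by
    refine measureReal_mono fun x hx => ⟨hx.1, ?_⟩
    have h2 : ∑ i, a i * x i ≤ b := hx.2
    have h3 := (hcx x (hA hx.1)).1
    change ∑ i, (c i : ℝ) * x i ≤ ((β + 1 : ℤ) : ℝ)
    push_cast
    linarith
  have hsub : B ∩ {x | ∑ i, (c i : ℝ) * x i ≤ ((β + 1 : ℤ) : ℝ)} ⊆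
      (B ∩ {x | ∑ i, a i * x i ≤ b}) ∪
        {x | ∑ i, (c i : ℝ) * x i ∈ Set.Ioc ((β : ℝ) - d) ((β : ℝ) - d + (d + 1))} := by
    intro x hx
    by_cases hxb : ∑ i, a i * x i ≤ b
    · exact Or.inl ⟨hx.1, hxb⟩
    · right
      have h2 : ∑ i, (c i : ℝ) * x i ≤ ((β + 1 : ℤ) : ℝ) := hx.2
      have h3 := (hcx x (hB hx.1)).2
      push_cast at h2
      constructor
      · linarith [not_le.1 hxb]
      · linarith
  have hci : (c i₀ : ℝ) ≠ 0 := by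
    intro h0
    rw [h0, abs_zero] at hcM
    exact hM0.ne hcM
  have hslab := cubeMeasure_real_slab_le (fun i => (c i : ℝ)) i₀ hci ((β : ℝ) - d) (d + 1)
    (by positivity)
  rw [hcM] at hslab
  have h4 := (measureReal_mono hsub (measure_ne_top μ _)).trans (measureReal_union_le _ _)
  have h5 := (abs_le.1 hnet).2
  simp only at h5
  linarith

theorem abs_measureReal_sub_le_of_halfspaceNet {d M : ℕ} (hM : 1 ≤ M) {A B : Set (Fin d → ℝ)}
    (hA : A ⊆ Set.Icc 0 1) (hB : B ⊆ Set.Icc 0 1) {δ : ℝ}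
    (h : ∀ q ∈ halfspaceNet d M, |(cubeMeasure (Fin d)).real (A ∩ {x | ∑ i, (q.1 i : ℝ) * x i ≤ q.2})
      - (cubeMeasure (Fin d)).real (B ∩ {x | ∑ i, (q.1 i : ℝ) * x i ≤ q.2})| ≤ δ)
    (a : Fin d → ℝ) (b : ℝ) :
    |(cubeMeasure (Fin d)).real (A ∩ {x | ∑ i, a i * x i ≤ b}) -
      (cubeMeasure (Fin d)).real (B ∩ {x | ∑ i, a i * x i ≤ b})| ≤ δ + (d + 1) / M := by
  have hM0 : (0 : ℝ) < M := by exact_mod_cast hM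
  by_cases ha : a = 0
  · have hδ : |(cubeMeasure (Fin d)).real A - (cubeMeasure (Fin d)).real B| ≤ δ := by
      have h0 := h (0, 0) (zero_mem_halfspaceNet d M)
      simpa using h0
    have hpos : (0 : ℝ) ≤ (d + 1) / M := by positivity
    have hδ0 : 0 ≤ δ := (abs_nonneg _).trans hδ
    by_cases hb : 0 ≤ b
    · simp [ha, hb]
      linarith
    · simp [ha, hb]
      linarith
  · obtain ⟨j, hj⟩ := Function.ne_iff.1 ha
    have : Nonempty (Fin d) := ⟨j⟩
    obtain ⟨i₀, hi₀⟩ := Finite.exists_max fun i => |a i|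
    have hpos : 0 < |a i₀| := (abs_pos.2 hj).trans_le (hi₀ j)
    set r := M / |a i₀| with hr
    have hr0 : 0 < r := by positivity
    have hset : {x : Fin d → ℝ | ∑ i, a i * x i ≤ b} =
        {x | ∑ i, (r * a i) * x i ≤ r * b} := by
      ext x
      simp only [Set.mem_ofPred_eq, mul_assoc, ← Finset.mul_sum]
      exact (mul_le_mul_iff_right₀ hr0).symm
    have h1 : ∀ i, |r * a i| ≤ M := by
      intro i
      rw [abs_mul, abs_of_pos hr0, hr, div_mul_eq_mul_div, div_le_iff₀ hpos]
      exact mul_le_mul_of_nonneg_left (hi₀ i) hM0.le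
    have h2 : |r * a i₀| = M := by
      rw [abs_mul, abs_of_pos hr0, hr, div_mul_cancel₀ _ hpos.ne']
    rw [hset, abs_le]
    have h3 := measureReal_le_of_halfspaceNet_of_normalized hM hA hB h _ (r * b) i₀ h1 h2
    have h4 := measureReal_le_of_halfspaceNet_of_normalized hM hB hA
      (fun q hq => by rw [abs_sub_comm]; exact h q hq) _ (r * b) i₀ h1 h2
    constructor <;> linarith

open scoped Pointwise in
theorem exists_convex_subset_of_volume_le {d : ℕ} (hd : 1 ≤ d) {K : Set (Fin d → ℝ)}
    (hK : Convex ℝ K) (hKc : IsCompact K) (h0 : 0 ∈ K) {v : ℝ} (hv : 0 < v)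
    (hvK : v ≤ volume.real K) :
    ∃ K' ⊆ K, Convex ℝ K' ∧ IsCompact K' ∧ volume.real K' = v := by
  have hκ : 0 < volume.real K := hv.trans_le hvK
  set q := v / volume.real K with hq
  have hq0 : 0 < q := by positivity
  have hq1 : q ≤ 1 := (div_le_one hκ).2 hvK
  set l := q ^ ((d : ℝ)⁻¹) with hl
  have hl0 : 0 < l := Real.rpow_pos_of_pos hq0 _
  have hl1 : l ≤ 1 := Real.rpow_le_one hq0.le hq1 (by positivity)
  have hld : l ^ d = q := Real.rpow_inv_natCast_pow hq0.le (by omega)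
  refine ⟨l • K, ?_, hK.smul l, hKc.smul l, ?_⟩
  · rintro _ ⟨x, hx, rfl⟩
    exact hK.smul_mem_of_zero_mem h0 hx ⟨hl0.le, hl1⟩
  · rw [measureReal_def, Measure.addHaar_smul, ENNReal.toReal_mul, ← measureReal_def,
      Module.finrank_fin_fun, hld, abs_of_pos hq0, ENNReal.toReal_ofReal hq0.le, hq,
      div_mul_cancel₀ _ hκ.ne']

theorem interior_nonempty_of_convex_of_volume_pos {d : ℕ} {K : Set (Fin d → ℝ)}
    (hK : Convex ℝ K) (hv : 0 < volume K) : (interior K).Nonempty := by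
  by_contra h
  rw [Set.not_nonempty_iff_eq_empty] at h
  have h1 : K ⊆ frontier K := by
    rw [frontier, h, Set.sdiff_empty]
    exact subset_closure
  exact hv.ne' (measure_mono_null h1 (hK.addHaar_frontier volume))

/-- Two halfspace-close convex bodies can be replaced by bodies of equal volume. -/
theorem exists_equal_volume_of_halfspace_close {d : ℕ} (hd : 1 ≤ d) {K L : Set (Fin d → ℝ)}
    {η τ : ℝ} (hK : Convex ℝ K) (hKc : IsCompact K) (hK0 : 0 ∈ K)
    (hL : Convex ℝ L) (hLc : IsCompact L) (hLK : volume.real L ≤ volume.real K)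
    (hL2 : 1 / 2 ≤ volume.real L) (hητ : 4 * η ≤ τ)
    (hclose : ∀ (a : Fin d → ℝ) (b : ℝ), |volume.real (K ∩ {x | ∑ i, a i * x i ≤ b}) -
      volume.real (L ∩ {x | ∑ i, a i * x i ≤ b})| ≤ η)
    (hfar : 1 / 8 * volume.real L < volume.real (L \ K)) :
    ∃ K L : Set (Fin d → ℝ),
        Convex ℝ K ∧ IsCompact K ∧ (interior K).Nonempty ∧
        Convex ℝ L ∧ IsCompact L ∧ (interior L).Nonempty ∧
        volume K = volume L ∧ 0 < volume K ∧
        (∀ (a : Fin d → ℝ) (b : ℝ),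
          |(volume (K ∩ {x | ∑ i, a i * x i ≤ b})).toReal / (volume K).toReal -
            (volume (L ∩ {x | ∑ i, a i * x i ≤ b})).toReal / (volume L).toReal| ≤ τ) ∧
        1 / 8 < (volume (K \ L)).toReal / (volume K).toReal := by
  have hL0 : 0 < volume.real L := by linarith
  obtain ⟨K', hK'K, hK', hK'c, hv⟩ := exists_convex_subset_of_volume_le hd hK hKc hK0 hL0 hLK
  have hfin : ∀ {A B : Set (Fin d → ℝ)}, IsCompact B → A ⊆ B → volume A ≠ ∞ := fun hB hAB =>
    measure_ne_top_of_subset hAB hB.measure_lt_top.ne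
  have hveq : volume K' = volume L :=
    (ENNReal.toReal_eq_toReal_iff' (hfin hK'c subset_rfl) (hfin hLc subset_rfl)).1 hv
  have hLpos : 0 < volume L := (ENNReal.toReal_pos_iff.1 hL0).1
  have hK'pos : 0 < volume K' := hveq ▸ hLpos
  have hdiff : volume.real (K \ K') ≤ η := by
    have h1 := (abs_le.1 (hclose 0 0)).2
    simp only [Pi.zero_apply, zero_mul, Finset.sum_const_zero, le_refl, Set.ofPred_true,
      Set.inter_univ] at h1
    have h2 := measureReal_sdiff_add_inter (μ := volume) (s := K) hK'c.isClosed.measurableSet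
      (hfin hKc subset_rfl)
    rw [Set.inter_eq_right.2 hK'K] at h2
    linarith
  refine ⟨K', L, hK', hK'c, interior_nonempty_of_convex_of_volume_pos hK' hK'pos, hL, hLc,
    interior_nonempty_of_convex_of_volume_pos hL hLpos, hveq, hK'pos, fun a b => ?_, ?_⟩
  · rw [hveq, ← sub_div, abs_div, ← measureReal_def, ← measureReal_def, ← measureReal_def,
      abs_of_pos hL0, div_le_iff₀ hL0]
    set H := {x : Fin d → ℝ | ∑ i, a i * x i ≤ b}
    have h1 := hclose a b
    have h2 : volume.real (K' ∩ H) ≤ volume.real (K ∩ H) :=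
      measureReal_mono (Set.inter_subset_inter_left _ hK'K) (hfin hKc Set.inter_subset_left)
    have h3 : volume.real (K ∩ H) ≤ volume.real (K' ∩ H) + volume.real (K \ K') := by
      refine (measureReal_mono (fun x hx => ?_) (hfin hKc (Set.union_subset
        (Set.inter_subset_left.trans hK'K) Set.sdiff_subset))).trans (measureReal_union_le _ _)
      by_cases hx' : x ∈ K'
      · exact Or.inl ⟨hx', hx.2⟩
      · exact Or.inr ⟨hx.1, hx'⟩
    have hη0 : 0 ≤ η := (abs_nonneg _).trans h1
    rw [abs_le] at h1
    have h4 : 2 * η ≤ τ * volume.real L := by nlinarith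
    rw [abs_le]
    constructor <;> linarith [h1.1, h1.2]
  · rw [← measureReal_def, ← measureReal_def, hv, lt_div_iff₀ hL0]
    refine hfar.trans_le ?_
    have h1 := measureReal_sdiff_add_inter (μ := volume) (s := K') hLc.isClosed.measurableSet
      (hfin hK'c subset_rfl)
    have h2 := measureReal_sdiff_add_inter (μ := volume) (s := L) hKc.isClosed.measurableSet
      (hfin hLc subset_rfl)
    have h3 : volume.real (K' ∩ L) ≤ volume.real (L ∩ K) :=
      measureReal_mono (fun x hx => ⟨hx.2, hK'K hx.1⟩) (hfin hLc Set.inter_subset_left)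
    linarith

theorem convex_carve_cap {ι : Type*} {k m N : ℕ} (e : Fin k × Fin m → ι) (s : ℝ)
    (S : Fin N → Fin k → Fin m) (ε : Fin N → Bool) :
    Convex ℝ (carve (fun i => cap e s (S i)) ε) := by
  have : carve (fun i => cap e s (S i)) ε =
      ⋂ i, ⋂ _ : ε i = true, {x | ∑ j, x (e (j, S i j)) ≤ k - s} := by
    ext x; simp [carve, cap]
  rw [this]
  refine convex_iInter fun i => convex_iInter fun _ => convex_halfSpace_le ⟨?_, ?_⟩ _
  · intro x y; simp [Finset.sum_add_distrib]
  · intro c x; simp [Finset.mul_sum]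

theorem isClosed_carve_cap {ι : Type*} {k m N : ℕ} (e : Fin k × Fin m → ι) (s : ℝ)
    (S : Fin N → Fin k → Fin m) (ε : Fin N → Bool) :
    IsClosed (carve (fun i => cap e s (S i)) ε) := by
  have : carve (fun i => cap e s (S i)) ε =
      ⋂ i, ⋂ _ : ε i = true, {x | ∑ j, x (e (j, S i j)) ≤ k - s} := by
    ext x; simp [carve, cap]
  rw [this]
  exact isClosed_iInter fun i => isClosed_iInter fun _ =>
    isClosed_le (by fun_prop) continuous_const

theorem exists_caps {ι : Type*} [Fintype ι] {k m N : ℕ} {e : Fin k × Fin m → ι} {s : ℝ}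
    (he : Function.Injective e) (hk : 1 ≤ k) (hs0 : 0 < s) (hs1 : s ≤ 1) (hm : 1 ≤ m) :
    ∃ S : Fin N → Fin k → Fin m,
      ∑ i, ∑ j, (if i = j then 0 else
        (cubeMeasure ι).real (cap e s (S i) ∩ cap e s (S j))) ≤
      N ^ 2 * ((cubeMeasure (Fin k)).real (corner (Fin k) s) ^ 2 *
        (1 + (k : ℝ) ^ k / (s * m)) ^ k) := by
  have : Nonempty (Fin m) := ⟨⟨0, hm⟩⟩
  obtain ⟨φ, hφ⟩ := exists_seq_sum_le
    (fun S T => (cubeMeasure ι).real (cap e s S ∩ cap e s T))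
    (fun S T => by rw [Set.inter_comm])
    ((cubeMeasure (Fin k)).real (corner (Fin k) s) ^ 2 * (1 + (k : ℝ) ^ k / (s * m)) ^ k)
    (by positivity) (fun S => sum_cubeMeasure_real_cap_inter_le he hk hs0 hs1 hm S) N
  refine ⟨fun i => φ i, ?_⟩
  simp_rw [Finset.sum_range] at hφ
  simpa only [Fin.ext_iff] using hφ

theorem exists_carve_close_and_far {d k n M : ℕ} {δ : ℝ} (hk : 1 ≤ k) (hn : 100 ≤ n)
    (hd : k * n ^ 2 ≤ d) (hδ0 : 0 < δ) (hδ1 : δ ≤ 1 / 1000)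
    (hkn : (1 + (k : ℝ) ^ k / n) ^ k ≤ 101 / 100)
    (hcard : 2 * (#(halfspaceNet d M) : ℝ) < Real.exp (δ ^ 2 * n ^ k)) :
    ∃ K L : Set (Fin d → ℝ), K ⊆ Set.Icc 0 1 ∧ L ⊆ Set.Icc 0 1 ∧ Convex ℝ K ∧ IsCompact K ∧
      0 ∈ K ∧ Convex ℝ L ∧ IsCompact L ∧ volume.real L ≤ volume.real K ∧
      1 / 2 ≤ volume.real L ∧
      (∀ q ∈ halfspaceNet d M,
        |(cubeMeasure (Fin d)).real (K ∩ {x | ∑ i, (q.1 i : ℝ) * x i ≤ q.2}) -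
          (cubeMeasure (Fin d)).real (L ∩ {x | ∑ i, (q.1 i : ℝ) * x i ≤ q.2})| ≤ δ) ∧
      1 / 8 * volume.real L < volume.real (L \ K) := by
  set μ := cubeMeasure (Fin d) with hμ
  set s : ℝ := (n : ℝ)⁻¹ with hs
  have hn0 : (0 : ℝ) < n := by exact_mod_cast (by omega : 0 < n)
  have hn1 : (100 : ℝ) ≤ n := by exact_mod_cast hn
  have hs0 : 0 < s := by positivity
  have hs1 : s ≤ 1 / 100 := by
    rw [hs, inv_eq_one_div]
    exact one_div_le_one_div_of_le (by norm_num) hn1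
  have hs1' : s ≤ 1 := by linarith
  set e : Fin k × Fin (n ^ 2) → Fin d := fun z => Fin.castLE hd (finProdFinEquiv z) with he'
  have he : Function.Injective e :=
    (Fin.castLE_injective hd).comp finProdFinEquiv.injective
  set p := (cubeMeasure (Fin k)).real (corner (Fin k) s) with hp
  have : Nonempty (Fin k) := ⟨⟨0, hk⟩⟩
  have hk0 : (0 : ℝ) < k := by exact_mod_cast hk
  have hp0 : 0 < p := by
    refine lt_of_lt_of_le ?_ (le_cubeMeasure_real_corner (Fin k) hs0.le hs1')
    rw [Fintype.card_fin]
    positivity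
  have hpn : p ≤ s ^ k := by
    simpa using cubeMeasure_real_corner_le (Fin k) hs0.le hs1'
  have hp1 : p ≤ 1 / 100 := hpn.trans ((pow_le_of_le_one hs0.le hs1' (by omega)).trans hs1)
  set N := ⌊1 / (2 * p)⌋₊ with hN
  have hNp : (N : ℝ) * p ≤ 1 / 2 := by
    have h1 : (N : ℝ) ≤ 1 / (2 * p) := Nat.floor_le (by positivity)
    calc (N : ℝ) * p ≤ 1 / (2 * p) * p := by gcongr
      _ = 1 / 2 := by field_simp
  have hNp' : 49 / 100 ≤ (N : ℝ) * p := by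
    have h1 : 1 / (2 * p) < N + 1 := Nat.lt_floor_add_one _
    have h2 : 1 / (2 * p) * p ≤ (N + 1) * p := by gcongr
    have h3 : 1 / (2 * p) * p = 1 / 2 := by field_simp
    linarith
  obtain ⟨S, hS⟩ := exists_caps (N := N) he hk hs0 hs1' (Nat.one_le_pow _ _ (by omega))
  have hsn : s * ((n ^ 2 : ℕ) : ℝ) = n := by
    push_cast
    rw [hs]
    field_simp
  rw [hsn] at hS
  have hS' : ∑ i, ∑ j, (if i = j then 0 else μ.real (cap e s (S i) ∩ cap e s (S j))) ≤
      101 / 400 := by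
    refine hS.trans ?_
    calc (N : ℝ) ^ 2 * (p ^ 2 * (1 + (k : ℝ) ^ k / n) ^ k)
        = (N * p) ^ 2 * (1 + (k : ℝ) ^ k / n) ^ k := by ring
      _ ≤ (1 / 2) ^ 2 * (101 / 100) := by gcongr
      _ = 101 / 400 := by norm_num
  set C : Fin N → Set (Fin d → ℝ) := fun i => cap e s (S i) with hC
  have hCm : ∀ i, MeasurableSet (C i) := fun i => measurableSet_cap (S i)
  have hCp : ∀ i, μ.real (C i) = p := fun i => cubeMeasure_real_cap he (S i)
  have hexp : Real.exp (δ ^ 2 * n ^ k) ≤ Real.exp (δ ^ 2 / p) := by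
    refine Real.exp_le_exp.2 ?_
    rw [le_div_iff₀ hp0, mul_assoc]
    refine mul_le_of_le_one_right (sq_nonneg _) ?_
    calc (n : ℝ) ^ k * p ≤ (n : ℝ) ^ k * s ^ k := by gcongr
      _ = 1 := by rw [← mul_pow, hs, mul_inv_cancel₀ hn0.ne', one_pow]
  obtain ⟨ε₀, hε₀⟩ := exists_carve_close (μ := μ) C (halfspaceNet d M)
    (fun q => {x | ∑ i, (q.1 i : ℝ) * x i ≤ q.2}) p δ hp0 hCp hNp (hcard.trans_le hexp) hδ0
  have hmeas : ∀ ε : Fin N → Bool, MeasurableSet (carve C ε) := measurableSet_carve hCm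
  obtain ⟨ε, hε, hle⟩ : ∃ ε : Fin N → Bool, (∀ q ∈ halfspaceNet d M,
      |μ.real (carve C ε ∩ {x | ∑ i, (q.1 i : ℝ) * x i ≤ q.2}) -
        μ.real (carve C (fun i => !ε i) ∩ {x | ∑ i, (q.1 i : ℝ) * x i ≤ q.2})| ≤ δ) ∧
      μ.real (carve C (fun i => !ε i)) ≤ μ.real (carve C ε) := by
    rcases le_total (μ.real (carve C (fun i => !ε₀ i))) (μ.real (carve C ε₀)) with h | h
    · exact ⟨ε₀, hε₀, h⟩
    · refine ⟨fun i => !ε₀ i, fun q hq => ?_, by simpa using h⟩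
      rw [abs_sub_comm]
      simpa using hε₀ q hq
  set ε' : Fin N → Bool := fun i => !ε i with hε'
  have hvol : ∀ A : Set (Fin d → ℝ), volume.real (A ∩ Set.Icc 0 1) = μ.real A := fun A => by
    rw [← cubeMeasure_real_eq Set.inter_subset_right, cubeMeasure_real_inter]
  have hinter : ∀ A H : Set (Fin d → ℝ), μ.real (A ∩ Set.Icc 0 1 ∩ H) = μ.real (A ∩ H) :=
    fun A H => by rw [Set.inter_right_comm, cubeMeasure_real_inter]
  have hhalf : 1 / 2 ≤ μ.real (carve C ε') := by
    have h1 : (carve C ε')ᶜ ⊆ ⋃ i ∈ (Finset.univ : Finset (Fin N)), C i := by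
      intro x hx
      simp only [carve, Set.mem_compl_iff, Set.mem_ofPred_eq, not_forall, not_not] at hx
      obtain ⟨i, -, hi⟩ := hx
      simp only [Set.mem_iUnion]
      exact ⟨i, Finset.mem_univ i, hi⟩
    have h2 := (measureReal_mono h1 (measure_ne_top μ _)).trans
      (measureReal_biUnion_finset_le _ _)
    rw [probReal_compl_eq_one_sub (hmeas ε')] at h2
    simp only [hCp, Finset.sum_const, Finset.card_univ, Fintype.card_fin, nsmul_eq_mul] at h2
    linarith
  have hzero : (0 : Fin d → ℝ) ∈ carve C ε := by
    intro i _ hi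
    have h1 : (k : ℝ) - s < ∑ j, (0 : Fin d → ℝ) (e (j, S i j)) := hi
    have h2 : (1 : ℝ) ≤ k := by exact_mod_cast hk
    simp only [Pi.zero_apply, Finset.sum_const_zero] at h1
    linarith
  refine ⟨carve C ε ∩ Set.Icc 0 1, carve C ε' ∩ Set.Icc 0 1, Set.inter_subset_right,
    Set.inter_subset_right, (convex_carve_cap e s S ε).inter (convex_Icc 0 1),
    isCompact_Icc.inter_left (isClosed_carve_cap e s S ε),
    ⟨hzero, le_refl _, zero_le_one⟩, (convex_carve_cap e s S ε').inter (convex_Icc 0 1),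
    isCompact_Icc.inter_left (isClosed_carve_cap e s S ε'), ?_, ?_, fun q hq => ?_, ?_⟩
  · rw [hvol, hvol]
    exact hle
  · rw [hvol]
    exact hhalf
  · rw [hinter, hinter]
    exact hε q hq
  · have hdiff : (carve C ε' ∩ Set.Icc 0 1) \ (carve C ε ∩ Set.Icc 0 1) =
        (carve C ε' \ carve C ε) ∩ Set.Icc 0 1 := by
      ext x
      simp only [Set.mem_sdiff, Set.mem_inter_iff]
      tauto
    rw [hdiff, hvol, hvol]
    have h1 := le_measureReal_carve_diff_add (μ := μ) C hCm ε
    simp only [hCp, Finset.sum_const, Finset.card_univ, Fintype.card_fin, nsmul_eq_mul] at h1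
    have h2 := (abs_le.1 (hε (0, 0) (zero_mem_halfspaceNet d M))).2
    simp only [Pi.zero_apply, Int.cast_zero, zero_mul, Finset.sum_const_zero, le_refl,
      Set.ofPred_true, Set.inter_univ] at h2
    have h3 := measureReal_sdiff_add_inter (μ := μ) (s := carve C ε) (hmeas ε')
    have h4 := measureReal_sdiff_add_inter (μ := μ) (s := carve C ε') (hmeas ε)
    rw [Set.inter_comm] at h4
    have h5 : μ.real (carve C ε) + μ.real (carve C ε' \ carve C ε) ≤ 1 := by
      rw [← measureReal_union Set.disjoint_sdiff_right ((hmeas ε').diff (hmeas ε))]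
      exact measureReal_le_one
    linarith

theorem exists_nat_parameter_bound (k C : ℕ) :
    ∃ n₀ : ℕ, ∀ n : ℕ, n₀ ≤ n → 100 ≤ n ∧ C ≤ n ∧ (1 + (k : ℝ) ^ k / n) ^ k ≤ 101 / 100 := by
  have h : Filter.Tendsto (fun n : ℕ => (1 + (k : ℝ) ^ k / n) ^ k) Filter.atTop (nhds 1) := by
    simpa using ((tendsto_const_div_atTop_nhds_zero_nat ((k : ℝ) ^ k)).const_add 1).pow k
  have h' : ∀ᶠ n : ℕ in Filter.atTop, 100 ≤ n ∧ C ≤ n ∧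
      (1 + (k : ℝ) ^ k / n) ^ k ≤ 101 / 100 :=
    (Filter.eventually_ge_atTop 100).and ((Filter.eventually_ge_atTop C).and
      (h.eventually (eventually_le_nhds (by norm_num))))
  exact Filter.eventually_atTop.1 h'

theorem two_mul_card_halfspaceNet_lt {d T k n : ℕ} (hT : 1 ≤ T) (hd : 125 ≤ d)
    (hk : k = 6 * T + 7) (hdn : d ≤ 4 * k * n ^ 2)
    (hn : 20480 * (4 * k) ^ (3 * T + 3) ≤ n) :
    2 * (#(halfspaceNet d (16 * d ^ (T + 1))) : ℝ) <
      Real.exp ((1 / (8 * (d : ℝ) ^ T)) ^ 2 * n ^ k) := by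
  have hd1 : 1 ≤ d := by omega
  have hdp : 1 ≤ d ^ (T + 1) := Nat.one_le_pow _ _ hd1
  set X : ℕ := 160 * d ^ (T + 2) with hX
  have hcard : 2 * #(halfspaceNet d (16 * d ^ (T + 1))) ≤ X ^ (d + 1) := by
    have hle : d ^ (T + 1) ≤ d ^ (T + 2) := Nat.pow_le_pow_right hd1 (by omega)
    have hdd : d ≤ d ^ (T + 2) := Nat.le_self_pow (by omega) d
    have h1 : 2 * (16 * d ^ (T + 1)) + 1 ≤ X := by omega
    have h2 : 2 * (2 * (16 * d ^ (T + 1)) * d + d + 2) ≤ X := by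
      have : 2 * (16 * d ^ (T + 1)) * d = 32 * d ^ (T + 2) := by ring
      omega
    rw [card_halfspaceNet]
    calc _ = (2 * (16 * d ^ (T + 1)) + 1) ^ d * (2 * (2 * (16 * d ^ (T + 1)) * d + d + 2)) := by
          ring
      _ ≤ X ^ d * X := Nat.mul_le_mul (Nat.pow_le_pow_left h1 d) h2
      _ = X ^ (d + 1) := (pow_succ _ _).symm
  have hnk : 20480 * d ^ (3 * T + 3) ≤ n ^ k :=
    calc 20480 * d ^ (3 * T + 3) ≤ 20480 * (4 * k * n ^ 2) ^ (3 * T + 3) := by gcongr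
      _ = 20480 * (4 * k) ^ (3 * T + 3) * n ^ (6 * T + 6) := by
          rw [mul_pow, ← pow_mul]
          ring_nf
      _ ≤ n * n ^ (6 * T + 6) := by gcongr
      _ = n ^ k := by rw [hk]; ring
  have hnk' : (20480 : ℝ) * d ^ (3 * T + 3) ≤ n ^ k := by exact_mod_cast hnk
  have hd0 : (0 : ℝ) < d := by exact_mod_cast hd1
  have hd1' : (1 : ℝ) ≤ d := by exact_mod_cast hd1
  have hexp : (X : ℝ) * (d + 1) ≤ (1 / (8 * (d : ℝ) ^ T)) ^ 2 * n ^ k :=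
    calc (X : ℝ) * (d + 1) ≤ 160 * (d : ℝ) ^ (T + 2) * (d + d) := by
          rw [hX]; push_cast; gcongr
      _ = (1 / (8 * (d : ℝ) ^ T)) ^ 2 * (20480 * d ^ (3 * T + 3)) := by
          field_simp
          ring
      _ ≤ _ := by gcongr
  calc 2 * (#(halfspaceNet d (16 * d ^ (T + 1))) : ℝ) ≤ (X : ℝ) ^ (d + 1) := by
        exact_mod_cast hcard
    _ < Real.exp X ^ (d + 1) := by
        refine pow_lt_pow_left₀ ?_ (by positivity) (by omega)
        linarith [Real.add_one_le_exp (X : ℝ)]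
    _ = Real.exp (X * (d + 1)) := by
        rw [← Real.exp_nat_mul]; push_cast; ring_nf
    _ ≤ _ := Real.exp_le_exp.2 hexp

/-- For every `t > 0` and all sufficiently large `d` there are convex bodies
`K, L ⊆ ℝ^d` of equal positive volume whose intersections with every halfspace
have volume fractions within `1/d^t` of each other, yet `dist(K, L) > 1/8`. -/
theorem exists_halfspace_close_far_bodies (t : ℝ) (ht : 0 < t) :
    ∃ d₀ : ℕ, ∀ d : ℕ, d₀ ≤ d →
      ∃ K L : Set (Fin d → ℝ),
        Convex ℝ K ∧ IsCompact K ∧ (interior K).Nonempty ∧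
        Convex ℝ L ∧ IsCompact L ∧ (interior L).Nonempty ∧
        volume K = volume L ∧ 0 < volume K ∧
        (∀ (a : Fin d → ℝ) (b : ℝ),
          |(volume (K ∩ {x | ∑ i, a i * x i ≤ b})).toReal / (volume K).toReal -
            (volume (L ∩ {x | ∑ i, a i * x i ≤ b})).toReal / (volume L).toReal|
            ≤ 1 / (d : ℝ) ^ t) ∧
        1 / 8 < (volume (K \ L)).toReal / (volume K).toReal := by
  set T := ⌈t⌉₊ with hTdef
  have hT : 1 ≤ T := Nat.one_le_ceil_iff.2 ht
  set k := 6 * T + 7 with hk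
  have hk1 : 1 ≤ k := by omega
  obtain ⟨n₀, hn₀⟩ := exists_nat_parameter_bound k (20480 * (4 * k) ^ (3 * T + 3))
  refine ⟨k * n₀ ^ 2 + 125, fun d hd => ?_⟩
  have hd125 : 125 ≤ d := le_trans (Nat.le_add_left _ _) hd
  have hd1 : 1 ≤ d := by omega
  set n := Nat.sqrt (d / k) with hn
  have hn₀n : n₀ ≤ n := by
    rw [hn, Nat.le_sqrt', Nat.le_div_iff_mul_le hk1]
    linarith
  obtain ⟨hn100, hnC, hkn⟩ := hn₀ n hn₀n
  have hknd : k * n ^ 2 ≤ d := by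
    have := (Nat.le_div_iff_mul_le hk1).1 (Nat.sqrt_le' (d / k))
    linarith
  have hdkn : d ≤ 4 * k * n ^ 2 := by
    have h1 : d < (n + 1) ^ 2 * k := (Nat.div_lt_iff_lt_mul hk1).1 (Nat.lt_succ_sqrt' (d / k))
    have h2 : (n + 1) ^ 2 ≤ (2 * n) ^ 2 := Nat.pow_le_pow_left (by omega) 2
    calc d ≤ (n + 1) ^ 2 * k := h1.le
      _ ≤ (2 * n) ^ 2 * k := Nat.mul_le_mul_right k h2
      _ = 4 * k * n ^ 2 := by ring
  have hd1' : (1 : ℝ) ≤ d := by exact_mod_cast hd1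
  have hd0 : (0 : ℝ) < d := by linarith
  have hdT : (125 : ℝ) ≤ (d : ℝ) ^ T := by
    exact_mod_cast hd125.trans (Nat.le_self_pow (by omega) d)
  set δ : ℝ := 1 / (8 * (d : ℝ) ^ T) with hδ
  have hδ0 : 0 < δ := by positivity
  have hδ1 : δ ≤ 1 / 1000 := one_div_le_one_div_of_le (by norm_num) (by linarith)
  obtain ⟨K, L, hKI, hLI, hK, hKc, hK0, hL, hLc, hLK, hL2, hnet, hfar⟩ :=
    exists_carve_close_and_far hk1 hn100 hknd hδ0 hδ1 hkn
      (two_mul_card_halfspaceNet_lt hT hd125 hk hdkn hnC)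
  refine exists_equal_volume_of_halfspace_close
    (η := δ + (d + 1) / (16 * d ^ (T + 1) : ℕ)) hd1 hK hKc hK0 hL hLc hLK hL2 ?_ ?_ hfar
  · calc 4 * (δ + (d + 1) / (16 * d ^ (T + 1) : ℕ))
        ≤ 4 * (δ + (d + d) / (16 * d ^ (T + 1) : ℕ)) := by gcongr
      _ = 1 / (d : ℝ) ^ (T : ℝ) := by
          rw [hδ, Real.rpow_natCast]
          push_cast
          field_simp
          ring
      _ ≤ 1 / (d : ℝ) ^ t := by
          refine one_div_le_one_div_of_le (by positivity) ?_
          exact Real.rpow_le_rpow_of_exponent_le hd1' (Nat.le_ceil t)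
  · intro a b
    rw [← cubeMeasure_real_eq (Set.inter_subset_left.trans hKI),
      ← cubeMeasure_real_eq (Set.inter_subset_left.trans hLI)]
    exact abs_measureReal_sub_le_of_halfspaceNet
      (by have := Nat.one_le_pow (T + 1) d hd1; omega) hKI hLI hnet a b
end
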